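/- arXiv:2106.06374 — 2 statements merged into one kernel-verified Lean document; each statement's English description precedes it below -/
import Mathlib

section
/- Let f : 𝔸 → 𝔸 be a homeomorphism of the annulus 𝔸 = S¹ × [0,1] satisfying the twist condition and the intersection property. Then f has at least one fixed point. -/
open Set Metric

noncomputable section

/-- The circle `S¹ = ℝ/ℤ`. -/
abbrev S1 : Type := AddCircle (1 : ℝ)

/-- The unit interval `[0,1]` as a type. -/
abbrev I01 : Type := Set.Icc (0 : ℝ) 1

/-- The annulus `𝔸 = S¹ × [0,1]`. -/
abbrev Ann : Type := S1 × I01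

def iZero : I01 := ⟨0, by norm_num⟩
def iOne : I01 := ⟨1, by norm_num⟩

/-- The boundary circle `A₀ = S¹ × {0}`. -/
def A0 : Set Ann := {p | p.2 = iZero}

/-- The boundary circle `A₁ = S¹ × {1}`. -/
def A1 : Set Ann := {p | p.2 = iOne}

/-- The covering map `ℝ × [0,1] → 𝔸`. -/
def annCover : ℝ × I01 → Ann := fun p => ((p.1 : S1), p.2)

/-- `F` is a lift of `f` through the covering map, commuting with the deck
transformation `(x,y) ↦ (x+1,y)`. -/
def IsLift (f : Ann → Ann) (F : ℝ × I01 → ℝ × I01) : Prop :=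
  (∀ p, annCover (F p) = f (annCover p)) ∧
  ∀ p : ℝ × I01, F (p.1 + 1, p.2) = ((F p).1 + 1, (F p).2)

/-- An essential simple closed curve in `Y`: a continuous injective map from the
circle which is not null-homotopic (not contractible). -/
def IsEssentialCurve {Y : Type*} [TopologicalSpace Y] (γ : C(S1, Y)) : Prop :=
  Function.Injective γ ∧ ¬ γ.Nullhomotopic

/-- `f` satisfies the intersection property if every essential simple closed curve
meets its image under `f`. -/
def IntersectionProperty {Y : Type*} [TopologicalSpace Y] (f : Y → Y) : Prop :=
  ∀ γ : C(S1, Y), IsEssentialCurve γ → (f '' Set.range γ ∩ Set.range γ).Nonempty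

/-- The twist condition: some lift `F` of `f` moves the two boundary lines in
opposite directions: `F(x,1) = (x + r₁ x, 1)`, `F(x,0) = (x - r₀ x, 0)` with
`r₀ x, r₁ x > 0`. -/
def TwistCondition (f : Ann → Ann) : Prop :=
  ∃ F : (ℝ × I01) ≃ₜ (ℝ × I01), IsLift f ⇑F ∧
    ∃ r₀ r₁ : ℝ → ℝ,
      (∀ x, 0 < r₀ x) ∧ (∀ x, 0 < r₁ x) ∧
      (∀ x : ℝ, F (x, iOne) = (x + r₁ x, iOne)) ∧
      (∀ x : ℝ, F (x, iZero) = (x - r₀ x, iZero))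

theorem exists_angle_lift {X : Type*} [TopologicalSpace X] [SimplyConnectedSpace X]
    [LocallyPathConnectedSpace X] {g : X → ℂ} (hg : Continuous g) (hne : ∀ x, g x ≠ 0)
    (x₀ : X) (θ₀ : ℝ) (h : (θ₀ : Real.Angle) = (Complex.arg (g x₀) : Real.Angle)) :
    ∃ θ : X → ℝ, Continuous θ ∧ θ x₀ = θ₀ ∧
      ∀ x, (θ x : Real.Angle) = (Complex.arg (g x) : Real.Angle) := by
  have hc : Continuous fun x => (Complex.arg (g x) : Real.Angle) :=
    continuous_iff_continuousAt.2 fun x =>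
      (Complex.continuousAt_arg_coe_angle (hne x)).comp hg.continuousAt
  obtain ⟨θ, ⟨h1, h2⟩, -⟩ :=
    (AddCircle.isCoveringMap_coe (2 * Real.pi)).existsUnique_continuousMap_lifts
      (⟨_, hc⟩ : C(X, AddCircle (2 * Real.pi))) x₀ θ₀ h
  exact ⟨θ, θ.continuous, h1, fun x => congrFun h2 x⟩

theorem re_im_of_angle_eq_arg {z : ℂ} {θ : ℝ}
    (h : (θ : Real.Angle) = (Complex.arg z : Real.Angle)) :
    z.re = ‖z‖ * Real.cos θ ∧ z.im = ‖z‖ * Real.sin θ := by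
  have hc : Real.cos θ = Real.cos z.arg := by
    rw [← Real.Angle.cos_coe, h, Real.Angle.cos_coe]
  have hs : Real.sin θ = Real.sin z.arg := by
    rw [← Real.Angle.sin_coe, h, Real.Angle.sin_coe]
  rw [hc, hs]
  exact ⟨(Complex.norm_mul_cos_arg z).symm, (Complex.norm_mul_sin_arg z).symm⟩

theorem IsPreconnected.mem_Ioo_of_avoids {X : Type*} [TopologicalSpace X] {s : Set X}
    (hs : IsPreconnected s) {d : X → ℝ} (hd : ContinuousOn d s) {a b : ℝ} {x₀ : X} (hx₀ : x₀ ∈ s)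
    (h0 : d x₀ ∈ Ioo a b) (hav : ∀ x ∈ s, d x ≠ a ∧ d x ≠ b) {x : X} (hx : x ∈ s) :
    d x ∈ Ioo a b := by
  have hoc := (hs.image d hd).ordConnected
  have h1 := mem_image_of_mem d hx
  have h2 := mem_image_of_mem d hx₀
  refine ⟨?_, ?_⟩
  · by_contra hcon
    obtain ⟨y, hy, hya⟩ := hoc.out h1 h2 ⟨not_lt.1 hcon, h0.1.le⟩
    exact (hav y hy).1 hya
  · by_contra hcon
    obtain ⟨y, hy, hya⟩ := hoc.out h2 h1 ⟨h0.2.le, not_lt.1 hcon⟩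
    exact (hav y hy).2 hya

theorem eq_neg_smul_of_angle {w z : ℂ} {α β : ℝ} (hz : z ≠ 0)
    (hα : (α : Real.Angle) = (Complex.arg w : Real.Angle))
    (hβ : (β : Real.Angle) = (Complex.arg z : Real.Angle))
    (h : α - β = Real.pi ∨ α - β = -Real.pi) :
    w = -((‖w‖ / ‖z‖ : ℝ) : ℂ) * z := by
  have hz' : ‖z‖ ≠ 0 := norm_ne_zero_iff.2 hz
  obtain ⟨h1, h2⟩ := re_im_of_angle_eq_arg hα
  obtain ⟨h3, h4⟩ := re_im_of_angle_eq_arg hβ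
  have hcos : Real.cos α = -Real.cos β := by
    rcases h with h | h
    · rw [show α = β + Real.pi by linarith, Real.cos_add_pi]
    · rw [show α = β - Real.pi by linarith, Real.cos_sub_pi]
  have hsin : Real.sin α = -Real.sin β := by
    rcases h with h | h
    · rw [show α = β + Real.pi by linarith, Real.sin_add_pi]
    · rw [show α = β - Real.pi by linarith, Real.sin_sub_pi]
  rw [← Complex.ofReal_neg]
  apply Complex.ext
  · rw [Complex.re_ofReal_mul, h3, h1, hcos]; field_simp
  · rw [Complex.im_ofReal_mul, h4, h2, hsin]; field_simp

/-- If `C` is a positive path for `G` climbing from bottom to top, then the direction of `F - id`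
turns by exactly `-π` along `C` as soon as `F - id` and `G - id` are nowhere opposite. -/
theorem angle_eq_zero_of_positive_path {F G : ℂ → ℂ} {C : ℝ → ℂ} {τ : ℝ} {θ : ℂ → ℝ}
    (hC : Continuous C) (hτ : 0 ≤ τ) (hCG : ∀ t ∈ Icc 0 τ, C (t + 1) = G (C t))
    (hne : ∀ s t, 0 ≤ s → s ≤ t → t ≤ τ → C (t + 1) ≠ C s)
    (hbot : ∀ t ∈ Icc 0 τ, (C 0).im < (C (t + 1)).im)
    (htop : ∀ s ∈ Icc 0 τ, (C s).im < (C (τ + 1)).im)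
    (hFne : ∀ z, F z ≠ z)
    (hopp : ∀ z, ∀ c : ℝ, 0 ≤ c → G z - z ≠ -(c : ℂ) * (F z - z))
    (hθ : Continuous θ)
    (hθF : ∀ z, (θ z : Real.Angle) = (Complex.arg (F z - z) : Real.Angle))
    (hθ0 : θ (C 0) = Real.pi) (hre : 0 < (F (C τ) - C τ).re) (him : (F (C τ) - C τ).im = 0) :
    θ (C τ) = 0 := by
  have hpi := Real.pi_pos
  set T : ℝ → ℝ := fun t => max 0 (min τ t) with hT
  set S : ℝ → ℝ → ℝ := fun s t => min (max 0 s) (T t) with hS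
  have hT0 : ∀ t, 0 ≤ T t := fun t => le_max_left _ _
  have hTτ : ∀ t, T t ≤ τ := fun t => max_le hτ (min_le_left _ _)
  have hTid : ∀ t ∈ Icc 0 τ, T t = t := fun t ht => by
    simp only [hT]; rw [min_eq_right ht.2, max_eq_right ht.1]
  have hTc : Continuous T := by fun_prop
  set g : ℝ × ℝ → ℂ := fun p => C (T p.2 + 1) - C (S p.1 p.2) with hgdef
  have hgc : Continuous g := by fun_prop
  have hgne : ∀ p, g p ≠ 0 := fun p =>
    sub_ne_zero.2 (hne _ _ (le_min (le_max_left _ _) (hT0 _)) (min_le_right _ _) (hTτ _))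
  obtain ⟨Θ, hΘc, hΘ0, hΘ⟩ := exists_angle_lift hgc hgne (0, 0) _ rfl
  have hleft : ∀ t ∈ Icc 0 τ, g (0, t) = C (t + 1) - C 0 := fun t ht => by
    simp [hgdef, hS, hTid t ht, ht.1]
  have hup : ∀ s ∈ Icc 0 τ, g (s, τ) = C (τ + 1) - C s := fun s hs => by
    simp [hgdef, hS, hTid τ ⟨hτ, le_rfl⟩, hs.1, hs.2]
  have hdiag : ∀ t ∈ Icc 0 τ, g (t, t) = G (C t) - C t := fun t ht => by
    simp [hgdef, hS, hTid t ht, ht.1, hCG t ht]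
  have h0 : (0 : ℝ) ∈ Icc 0 τ := ⟨le_rfl, hτ⟩
  have h1 : τ ∈ Icc 0 τ := ⟨hτ, le_rfl⟩
  have avoid : ∀ p, 0 < (g p).im → Θ p ≠ 0 ∧ Θ p ≠ Real.pi := fun p hp => by
    have h := (re_im_of_angle_eq_arg (hΘ p)).2
    constructor <;> intro hcon <;> rw [hcon] at h <;> simp at h <;> linarith
  have hleftpos : ∀ t ∈ Icc 0 τ, 0 < (g (0, t)).im := fun t ht => by
    rw [hleft t ht, Complex.sub_im]; linarith [hbot t ht]
  have huppos : ∀ s ∈ Icc 0 τ, 0 < (g (s, τ)).im := fun t ht => by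
    rw [hup t ht, Complex.sub_im]; linarith [htop t ht]
  have hstart : Θ (0, 0) ∈ Ioo 0 Real.pi := by
    have h := avoid (0, 0) (hleftpos 0 h0)
    have h2 := Complex.arg_nonneg_iff.2 (hleftpos 0 h0).le
    rw [hΘ0] at h ⊢
    exact ⟨lt_of_le_of_ne h2 h.1.symm, lt_of_le_of_ne (Complex.arg_le_pi _) h.2⟩
  have hcorner : Θ (0, τ) ∈ Ioo 0 Real.pi :=
    isPreconnected_Icc.mem_Ioo_of_avoids (d := fun t => Θ (0, t)) (by fun_prop) h0 hstart
      (fun t ht => avoid _ (hleftpos t ht)) h1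
  have hend : Θ (τ, τ) ∈ Ioo 0 Real.pi :=
    isPreconnected_Icc.mem_Ioo_of_avoids (d := fun s => Θ (s, τ)) (by fun_prop) h0 hcorner
      (fun t ht => avoid _ (huppos t ht)) h1
  have hdiff : Θ (τ, τ) - θ (C τ) ∈ Ioo (-Real.pi) Real.pi := by
    refine isPreconnected_Icc.mem_Ioo_of_avoids (d := fun t => Θ (t, t) - θ (C t))
      (by fun_prop) h0 ⟨?_, ?_⟩ (fun t ht => ?_) h1
    · simp only [hθ0]; linarith [hstart.1]
    · simp only [hθ0]; linarith [hstart.2]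
    · by_contra hcon
      have hh : Θ (t, t) - θ (C t) = Real.pi ∨ Θ (t, t) - θ (C t) = -Real.pi := by tauto
      have h2 := hΘ (t, t)
      rw [hdiag t ht] at h2
      exact hopp (C t) _ (by positivity)
        (eq_neg_smul_of_angle (sub_ne_zero.2 (hFne _)) h2 (hθF (C t)) hh)
  have harg : Complex.arg (F (C τ) - C τ) = 0 := Complex.arg_eq_zero_iff.2 ⟨hre.le, him⟩
  have hz := hθF (C τ)
  rw [harg, Real.Angle.angle_eq_iff_two_pi_dvd_sub] at hz
  obtain ⟨k, hk⟩ := hz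
  have hk1 : (-1 : ℝ) < k := by nlinarith [hdiff.1, hdiff.2, hend.1, hend.2]
  have hk2 : (k : ℝ) < 1 := by nlinarith [hdiff.1, hdiff.2, hend.1, hend.2]
  have : k = 0 := by
    have h1 : (-1 : ℤ) < k := by exact_mod_cast hk1
    have h2 : k < (1 : ℤ) := by exact_mod_cast hk2
    omega
  subst this
  simpa using hk

/-- A tent function of radius `ρ` centred at `c`. -/
def tent (ρ : ℝ) (c x : ℂ) : ℝ := max 0 (1 - ‖x - c‖ / ρ)

theorem continuous_tent (ρ : ℝ) (c : ℂ) : Continuous (tent ρ c) := by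
  unfold tent; fun_prop

theorem tent_nonneg (ρ : ℝ) (c x : ℂ) : 0 ≤ tent ρ c x := le_max_left _ _

theorem tent_le_one {ρ : ℝ} (hρ : 0 < ρ) (c x : ℂ) : tent ρ c x ≤ 1 :=
  max_le zero_le_one (by linarith [div_nonneg (norm_nonneg (x - c)) hρ.le])

theorem tent_self (ρ : ℝ) (c : ℂ) : tent ρ c c = 1 := by simp [tent]

theorem tent_eq_zero {ρ : ℝ} (hρ : 0 < ρ) {c x : ℂ} (h : ρ ≤ ‖x - c‖) : tent ρ c x = 0 :=
  max_eq_left (by linarith [(one_le_div hρ).2 h])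

theorem abs_tent_sub_le {ρ : ℝ} (hρ : 0 < ρ) (c x y : ℂ) :
    |tent ρ c x - tent ρ c y| ≤ ‖x - y‖ / ρ := by
  unfold tent
  refine (abs_max_sub_max_le_max _ _ _ _).trans (max_le (by simp; positivity) ?_)
  rw [show 1 - ‖x - c‖ / ρ - (1 - ‖y - c‖ / ρ) = (‖y - c‖ - ‖x - c‖) / ρ by ring, abs_div,
    abs_of_pos hρ]
  gcongr
  have := abs_norm_sub_norm_le (y - c) (x - c)
  rwa [show y - c - (x - c) = y - x by ring, norm_sub_rev y x] at this

/-- Push finitely many well separated points `p i` to nearby points `q i`. -/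
theorem exists_push {ι : Type*} (s : Finset ι) (p q : ι → ℂ) {ρ η : ℝ} (hρ : 0 < ρ) (hη : 0 ≤ η)
    (hηρ : η < ρ / 4) (hsep : ∀ i ∈ s, ∀ j ∈ s, i ≠ j → 3 * ρ ≤ ‖p i - p j‖)
    (hpq : ∀ i ∈ s, ‖q i - p i‖ ≤ η) :
    ∃ h : ℂ → ℂ, Continuous h ∧ Function.Injective h ∧ (∀ x, ‖h x - x‖ ≤ η) ∧
      (∀ i ∈ s, h (p i) = q i) ∧ ∀ x, (∀ i ∈ s, ρ ≤ ‖x - p i‖) → h x = x := by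
  set h : ℂ → ℂ := fun x => x + ∑ i ∈ s, (tent ρ (p i) x : ℂ) * (q i - p i) with hh
  have far : ∀ i ∈ s, ∀ x, ‖x - p i‖ < ρ → ∀ j ∈ s, j ≠ i → 2 * ρ ≤ ‖x - p j‖ := by
    intro i hi x hx j hj hji
    have h1 := hsep i hi j hj hji.symm
    have h2 : ‖p i - p j‖ ≤ ‖x - p i‖ + ‖x - p j‖ := by
      rw [norm_sub_rev x (p i)]
      simpa using norm_add_le (p i - x) (x - p j)
    linarith
  have near : ∀ i ∈ s, ∀ x, ‖x - p i‖ < ρ → h x = x + (tent ρ (p i) x : ℂ) * (q i - p i) := by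
    intro i hi x hx
    simp only [hh]
    rw [Finset.sum_eq_single i]
    · intro j hj hji
      rw [tent_eq_zero hρ (by linarith [far i hi x hx j hj hji])]; simp
    · exact fun hcon => absurd hi hcon
  have out : ∀ x, (∀ i ∈ s, ρ ≤ ‖x - p i‖) → h x = x := by
    intro x hx
    simp only [hh]
    rw [Finset.sum_eq_zero, add_zero]
    intro i hi
    rw [tent_eq_zero hρ (hx i hi)]; simp
  have disp : ∀ x, ‖h x - x‖ ≤ η := by
    intro x
    by_cases hx : ∃ i ∈ s, ‖x - p i‖ < ρ
    · obtain ⟨i, hi, hxi⟩ := hx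
      rw [near i hi x hxi, add_sub_cancel_left, norm_mul, Complex.norm_real, Real.norm_eq_abs,
        abs_of_nonneg (tent_nonneg _ _ _)]
      nlinarith [hpq i hi, tent_le_one hρ (p i) x, tent_nonneg ρ (p i) x, norm_nonneg (q i - p i)]
    · push Not at hx
      rw [out x hx]; simpa using hη
  have close : ∀ x y, h x = h y → ‖x - y‖ ≤ 2 * η := by
    intro x y hxy
    have := norm_add_le (x - h x) (h y - y)
    rw [show x - h x + (h y - y) = x - y by rw [hxy]; ring, norm_sub_rev x (h x)] at this
    linarith [disp x, disp y]
  have key : ∀ x y, h x = h y → ∀ i ∈ s, h x = x + (tent ρ (p i) x : ℂ) * (q i - p i) →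
      h y = y + (tent ρ (p i) y : ℂ) * (q i - p i) → x = y := by
    intro x y hxy i hi hx hy
    have e : x - y = ((tent ρ (p i) y - tent ρ (p i) x : ℝ) : ℂ) * (q i - p i) := by
      have := hx.symm.trans (hxy.trans hy)
      push_cast; linear_combination this
    have e2 : ‖x - y‖ ≤ ‖y - x‖ / ρ * η := by
      conv_lhs => rw [e]
      rw [norm_mul, Complex.norm_real, Real.norm_eq_abs]
      exact mul_le_mul (abs_tent_sub_le hρ _ _ _) (hpq i hi) (norm_nonneg _) (by positivity)
    rw [norm_sub_rev y x] at e2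
    have e3 : η / ρ ≤ 1 / 4 := by rw [div_le_iff₀ hρ]; linarith
    have e4 : ‖x - y‖ / ρ * η = ‖x - y‖ * (η / ρ) := by ring
    have e5 : ‖x - y‖ = 0 := by nlinarith [norm_nonneg (x - y)]
    exact sub_eq_zero.1 (norm_eq_zero.1 e5)
  have tri : ∀ x y i, ‖y - p i‖ ≤ ‖x - y‖ + ‖x - p i‖ := by
    intro x y i
    rw [norm_sub_rev x y]
    simpa using norm_add_le (y - x) (x - p i)
  refine ⟨h, ?_, ?_, disp, ?_, out⟩
  · have := continuous_tent ρ
    simp only [hh]; fun_prop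
  · have main : ∀ x y, h x = h y → (∃ i ∈ s, ‖x - p i‖ < ρ) → x = y := by
      rintro x y hxy ⟨i, hi, hxi⟩
      have hy : h y = y + (tent ρ (p i) y : ℂ) * (q i - p i) := by
        by_cases hyi : ‖y - p i‖ < ρ
        · exact near i hi y hyi
        · rw [tent_eq_zero hρ (not_lt.1 hyi), out y]
          · simp
          · intro j hj
            by_cases hji : j = i
            · subst hji; exact not_lt.1 hyi
            · have h1 := far i hi x hxi j hj hji
              have h2 := tri y x j
              rw [norm_sub_rev y x] at h2
              linarith [close x y hxy]
      exact key x y hxy i hi (near i hi x hxi) hy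
    intro x y hxy
    by_cases hx : ∃ i ∈ s, ‖x - p i‖ < ρ
    · exact main x y hxy hx
    by_cases hy : ∃ i ∈ s, ‖y - p i‖ < ρ
    · exact (main y x hxy.symm hy).symm
    · push Not at hx hy
      rw [out x hx, out y hy] at hxy
      exact hxy
  · intro i hi
    rw [near i hi _ (by simpa using hρ), tent_self]; simp

/-- Transport finitely many points along straight segments that are never simultaneously
at the same place. -/
theorem exists_transport (s : Finset (ℂ × ℂ)) {ε m : ℝ} (hε : 0 ≤ ε)
    (hclose : ∀ a ∈ s, ‖a.2 - a.1‖ ≤ ε) (him : ∀ a ∈ s, m < a.1.im ∧ m < a.2.im)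
    (hcol : ∀ a ∈ s, ∀ b ∈ s, a ≠ b → (0 : ℂ) ∉ segment ℝ (a.1 - b.1) (a.2 - b.2)) :
    ∃ h : ℂ → ℂ, Continuous h ∧ Function.Injective h ∧ (∀ x, ‖h x - x‖ ≤ ε) ∧
      (∀ a ∈ s, h a.1 = a.2) ∧ ∀ x : ℂ, x.im ≤ m → h x = x := by
  set P : ℝ → ℂ × ℂ → ℂ := fun t a => a.1 + (t : ℂ) * (a.2 - a.1) with hP
  have hsep : ∃ ρ > 0, ∀ a ∈ s, ∀ b ∈ s, a ≠ b → ∀ t ∈ Icc (0 : ℝ) 1,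
      3 * ρ ≤ ‖P t a - P t b‖ := by
    have hpair : ∀ c : (ℂ × ℂ) × (ℂ × ℂ), ∃ ρ > 0, c.1 ∈ s → c.2 ∈ s → c.1 ≠ c.2 →
        ∀ t ∈ Icc (0 : ℝ) 1, 3 * ρ ≤ ‖P t c.1 - P t c.2‖ := by
      rintro ⟨a, b⟩
      by_cases hab : a ∈ s ∧ b ∈ s ∧ a ≠ b
      · obtain ⟨ha, hb, hne⟩ := hab
        obtain ⟨t₀, ht₀, hmin⟩ := isCompact_Icc.exists_isMinOn (nonempty_Icc.2 zero_le_one)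
          (f := fun t : ℝ => ‖P t a - P t b‖) (by simp only [hP]; fun_prop)
        have hpos : 0 < ‖P t₀ a - P t₀ b‖ := by
          rw [norm_pos_iff]
          intro h0
          refine hcol a ha b hb hne ⟨1 - t₀, t₀, by linarith [ht₀.2], ht₀.1, by ring, ?_⟩
          rw [← h0]; simp only [hP, Complex.real_smul]; push_cast; ring
        exact ⟨‖P t₀ a - P t₀ b‖ / 3, by positivity, fun _ _ _ t ht => by
          have : ‖P t₀ a - P t₀ b‖ ≤ ‖P t a - P t b‖ := hmin ht
          linarith⟩
      · exact ⟨1, one_pos, fun h1 h2 h3 => absurd ⟨h1, h2, h3⟩ hab⟩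
    choose ρ hρ hρs using hpair
    rcases (s ×ˢ s).eq_empty_or_nonempty with he | hne
    · refine ⟨1, one_pos, fun a ha => ?_⟩
      exact absurd (Finset.mk_mem_product ha ha) (by simp [he])
    · obtain ⟨c, hc, hmin⟩ := Finset.exists_min_image (s ×ˢ s) ρ hne
      exact ⟨ρ c, hρ c, fun a ha b hb hab t ht => by
        have h1 := hmin (a, b) (Finset.mk_mem_product ha hb)
        have h2 := hρs (a, b) ha hb hab t ht
        simp only at h2; linarith⟩
  obtain ⟨ρ₀, hρ₀, hsep⟩ := hsep
  have hmarg : ∃ μ > 0, ∀ a ∈ s, m + μ ≤ a.1.im ∧ m + μ ≤ a.2.im := by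
    rcases s.eq_empty_or_nonempty with he | hne
    · exact ⟨1, one_pos, by simp [he]⟩
    · obtain ⟨c, hc, hmin⟩ := Finset.exists_min_image s (fun a => min a.1.im a.2.im) hne
      refine ⟨min c.1.im c.2.im - m, sub_pos.2 (lt_min (him c hc).1 (him c hc).2), fun a ha => ?_⟩
      have := hmin a ha
      have h1 := min_le_left a.1.im a.2.im
      have h2 := min_le_right a.1.im a.2.im
      constructor <;> linarith
  obtain ⟨μ, hμ, hmarg⟩ := hmarg
  set ρ := min ρ₀ μ with hρdef
  have hρ : 0 < ρ := lt_min hρ₀ hμ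
  obtain ⟨N, hN⟩ := exists_nat_gt (4 * ε / ρ)
  have hNpos : (0 : ℝ) < N := lt_of_le_of_lt (by positivity) hN
  have hη : ε / N < ρ / 4 := by
    rw [div_lt_iff₀ hρ] at hN
    rw [div_lt_iff₀ hNpos]; linarith
  have main : ∀ k : ℕ, k ≤ N → ∃ h : ℂ → ℂ, Continuous h ∧ Function.Injective h ∧
      (∀ x, ‖h x - x‖ ≤ k * (ε / N)) ∧ (∀ a ∈ s, h a.1 = P (k / N) a) ∧
      ∀ x : ℂ, x.im ≤ m → h x = x := by
    intro k
    induction k with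
    | zero =>
      exact fun _ => ⟨id, continuous_id, Function.injective_id, by simp, by simp [hP], by simp⟩
    | succ k ih =>
      intro hk
      obtain ⟨h, hc, hi, hd, hs, hid⟩ := ih (by omega)
      have hkN : (k : ℝ) + 1 ≤ N := by exact_mod_cast hk
      have hk01 : (k / N : ℝ) ∈ Icc (0 : ℝ) 1 :=
        ⟨by positivity, by rw [div_le_one hNpos]; linarith⟩
      obtain ⟨h', hc', hi', hd', hs', hid'⟩ := exists_push s (P (k / N)) (P ((k + 1 : ℕ) / N)) hρ
        (by positivity : 0 ≤ ε / N) hη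
        (fun a ha b hb hab => by
          have := hsep a ha b hb hab _ hk01
          have := min_le_left ρ₀ μ
          linarith)
        (fun a ha => by
          have : P ((k + 1 : ℕ) / N) a - P (k / N) a = ((1 / N : ℝ) : ℂ) * (a.2 - a.1) := by
            simp only [hP]; push_cast; ring
          rw [this, norm_mul, Complex.norm_real, Real.norm_eq_abs, abs_of_pos (by positivity)]
          have := hclose a ha
          rw [one_div, inv_mul_eq_div]
          gcongr)
      refine ⟨h' ∘ h, hc'.comp hc, hi'.comp hi, fun x => ?_, fun a ha => ?_, fun x hx => ?_⟩
      · have := norm_add_le (h' (h x) - h x) (h x - x)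
        rw [sub_add_sub_cancel] at this
        push_cast
        simp only [Function.comp]
        linarith [hd' (h x), hd x]
      · simp only [Function.comp]; rw [hs a ha, hs' a ha]
      · simp only [Function.comp]
        rw [hid x hx]
        refine hid' x fun a ha => ?_
        have h1 := Complex.abs_im_le_norm (x - P (k / N) a)
        have h2 : (P (k / N) a).im = (1 - k / N) * a.1.im + (k / N) * a.2.im := by
          have : P (k / N) a = a.1 + ((k / N : ℝ) : ℂ) * (a.2 - a.1) := by simp [hP]
          rw [this, Complex.add_im, Complex.im_ofReal_mul, Complex.sub_im]; ring
        have h3 : m + μ ≤ (P (k / N) a).im := by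
          rw [h2]
          have h4 := hmarg a ha
          have h5 : 0 ≤ 1 - (k / N : ℝ) := by linarith [hk01.2]
          have h6 := hk01.1
          nlinarith [mul_le_mul_of_nonneg_left h4.1 h5, mul_le_mul_of_nonneg_left h4.2 h6]
        have h4 := min_le_right ρ₀ μ
        have h5 := neg_abs_le (x - P (k / N) a).im
        rw [Complex.sub_im] at h5 h1
        linarith
  obtain ⟨h, hc, hi, hd, hs, hid⟩ := main N le_rfl
  refine ⟨h, hc, hi, fun x => ?_, fun a ha => ?_, hid⟩
  · have := hd x
    rwa [mul_div_cancel₀ _ hNpos.ne'] at this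
  · rw [hs a ha, div_self hNpos.ne']; simp [hP]

theorem volume_line_eq_zero (p d : ℂ) :
    MeasureTheory.volume {w : ℂ | ∃ c : ℝ, w = p + (c : ℂ) * d} = 0 := by
  have hs : AffineSubspace.mk' p (Submodule.span ℝ {d}) ≠ ⊤ := by
    intro h
    have h1 := congrArg AffineSubspace.direction h
    rw [AffineSubspace.direction_mk', AffineSubspace.direction_top] at h1
    have h2 := finrank_span_finset_le_card (R := ℝ) ({d} : Finset ℂ)
    rw [Finset.coe_singleton, Set.finrank, h1, finrank_top, Complex.finrank_real_complex,
      Finset.card_singleton] at h2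
    omega
  refine MeasureTheory.measure_mono_null ?_
    (MeasureTheory.Measure.addHaar_affineSubspace MeasureTheory.volume _ hs)
  rintro w ⟨c, rfl⟩
  simp only [SetLike.mem_coe, AffineSubspace.mem_mk', vsub_eq_sub, add_sub_cancel_left]
  exact Submodule.mem_span_singleton.2 ⟨c, by simp⟩

/-- Points from which some `ε`-chain of `G` with `k` steps above height `m` gets higher than `a`. -/
def chainSet (G : ℂ → ℂ) (ε m a : ℝ) : ℕ → Set ℂ
  | 0 => {z | a < z.im}
  | k + 1 => {z | m < (G z).im ∧ ∃ w ∈ chainSet G ε m a k, m < w.im ∧ ‖w - G z‖ < ε}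

theorem isOpen_chainSet {G : ℂ → ℂ} (hG : Continuous G) (ε m a : ℝ) (k : ℕ) :
    IsOpen (chainSet G ε m a k) := by
  cases k with
  | zero => exact isOpen_lt continuous_const Complex.continuous_im
  | succ k =>
    have : chainSet G ε m a (k + 1) = {z | m < (G z).im} ∩
        ⋃ w ∈ {w | w ∈ chainSet G ε m a k ∧ m < w.im}, {z | ‖w - G z‖ < ε} := by
      ext z; simp only [chainSet, mem_ofPred_eq, mem_inter_iff, mem_iUnion, exists_prop, and_assoc]
    rw [this]
    refine (isOpen_lt continuous_const (Complex.continuous_im.comp hG)).inter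
      (isOpen_biUnion fun w _ => isOpen_lt (by fun_prop) continuous_const)

/-- A set of jumps that can be performed simultaneously by a small homeomorphism. -/
def IsJumpSet (ε m : ℝ) (S : Finset (ℂ × ℂ)) : Prop :=
  (∀ a ∈ S, ‖a.2 - a.1‖ ≤ ε) ∧ (∀ a ∈ S, m < a.1.im ∧ m < a.2.im) ∧
    ∀ a ∈ S, ∀ b ∈ S, a ≠ b → (0 : ℂ) ∉ segment ℝ (a.1 - b.1) (a.2 - b.2)

theorem exists_generic_jump {G : ℂ → ℂ} (hGi : Function.Injective G) {O : Set ℂ} (hO : IsOpen O)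
    (hne : O.Nonempty) (S : Finset (ℂ × ℂ)) (u : ℂ) :
    ∃ w ∈ O, (∀ a ∈ S, ∀ c : ℝ, w ≠ a.2 + (c : ℂ) * (u - a.1)) ∧ G w ≠ u ∧
      ∀ a ∈ S, G w ≠ a.1 := by
  have hnull : MeasureTheory.volume ((⋃ a ∈ S, {w : ℂ | ∃ c : ℝ, w = a.2 + (c : ℂ) * (u - a.1)}) ∪
      G ⁻¹' (insert u (S.image Prod.fst : Finset ℂ) : Set ℂ)) = 0 := by
    rw [MeasureTheory.measure_union_null_iff]
    refine ⟨?_, ?_⟩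
    · refine (MeasureTheory.measure_biUnion_null_iff S.countable_toSet).2 ?_
      exact fun a _ => volume_line_eq_zero _ _
    · exact (((Finset.finite_toSet _).insert u).preimage hGi.injOn).measure_zero _
  have hpos := hO.measure_pos MeasureTheory.volume hne
  obtain ⟨w, hw, hwn⟩ : ∃ w ∈ O, w ∉ (⋃ a ∈ S, {w : ℂ | ∃ c : ℝ, w = a.2 + (c : ℂ) * (u - a.1)}) ∪
      G ⁻¹' (insert u (S.image Prod.fst : Finset ℂ) : Set ℂ) := by
    by_contra hcon
    push Not at hcon
    exact hpos.ne' (MeasureTheory.measure_mono_null hcon hnull)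
  simp only [mem_union, mem_iUnion, mem_ofPred_eq, mem_preimage, mem_insert_iff, Finset.coe_image,
    mem_image, Finset.mem_coe, not_or, not_exists, not_and] at hwn
  exact ⟨w, hw, fun a ha c => by simpa using hwn.1 a ha c, hwn.2.1,
    fun a ha h => hwn.2.2 a ha h.symm⟩

theorem IsJumpSet.insert {ε m : ℝ} {S : Finset (ℂ × ℂ)} (hS : IsJumpSet ε m S) {u w : ℂ}
    (hu : m < u.im) (hw : m < w.im) (huw : ‖w - u‖ ≤ ε) (huS : ∀ a ∈ S, u ≠ a.1)
    (hline : ∀ a ∈ S, ∀ c : ℝ, w ≠ a.2 + (c : ℂ) * (u - a.1)) :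
    IsJumpSet ε m (Insert.insert (u, w) S) := by
  have key : ∀ a ∈ S, (0 : ℂ) ∉ segment ℝ (u - a.1) (w - a.2) := by
    rintro a ha ⟨x, y, hx, hy, hxy, h⟩
    simp only [Complex.real_smul] at h
    rcases hy.eq_or_lt with h0 | h0
    · subst h0
      obtain rfl : x = 1 := by linarith
      exact huS a ha (sub_eq_zero.1 (by simpa using h))
    · refine hline a ha (-(x / y)) ?_
      have : (y : ℂ) ≠ 0 := by exact_mod_cast h0.ne'
      push_cast
      field_simp
      linear_combination h
  refine ⟨?_, ?_, ?_⟩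
  · intro a ha
    rcases Finset.mem_insert.1 ha with rfl | ha
    exacts [huw, hS.1 a ha]
  · intro a ha
    rcases Finset.mem_insert.1 ha with rfl | ha
    exacts [⟨hu, hw⟩, hS.2.1 a ha]
  · intro a ha b hb hab
    rcases Finset.mem_insert.1 ha with rfl | ha <;> rcases Finset.mem_insert.1 hb with rfl | hb
    · exact absurd rfl hab
    · exact key b hb
    · intro h
      refine key a ha ?_
      obtain ⟨x, y, hx, hy, hxy, h⟩ := h
      refine ⟨x, y, hx, hy, hxy, ?_⟩
      simp only [Complex.real_smul] at h ⊢
      linear_combination -h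
    · exact hS.2.2 a ha b hb hab

theorem exists_generic_chain {G : ℂ → ℂ} (hG : Continuous G) (hGi : Function.Injective G)
    {ε m a : ℝ} (k : ℕ) : ∀ (S : Finset (ℂ × ℂ)) (z : ℂ), IsJumpSet ε m S → z ∈ chainSet G ε m a k →
      (∀ b ∈ S, G z ≠ b.1) → ∃ S' : Finset (ℂ × ℂ), S ⊆ S' ∧ IsJumpSet ε m S' ∧ ∃ w : ℕ → ℂ,
        w 0 = z ∧ (∀ i < k, (G (w i), w (i + 1)) ∈ S') ∧ a < (w k).im := by
  induction k with
  | zero => exact fun S z hS hz _ => ⟨S, subset_rfl, hS, fun _ => z, rfl, by simp, hz⟩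
  | succ k ih =>
    rintro S z hS ⟨hu, hz⟩ hzS
    obtain ⟨w, ⟨⟨hw, hwm⟩, hwu⟩, hline, hwz, hwS⟩ := exists_generic_jump hGi
      (((isOpen_chainSet hG ε m a k).inter (isOpen_lt continuous_const Complex.continuous_im)).inter
        (isOpen_lt (f := fun w => ‖w - G z‖) (g := fun _ => ε) (by fun_prop) continuous_const))
      (by obtain ⟨w, h1, h2, h3⟩ := hz; exact ⟨w, ⟨h1, h2⟩, h3⟩) S (G z)
    obtain ⟨S', hSS', hS', v, hv0, hv, hva⟩ := ih (Insert.insert (G z, w) S) w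
      (hS.insert hu hwm (le_of_lt hwu) hzS hline) hw (by
        intro b hb
        rcases Finset.mem_insert.1 hb with rfl | hb
        exacts [hwz, hwS b hb])
    refine ⟨S', (Finset.subset_insert _ _).trans hSS', hS',
      fun i => Nat.casesOn i z v, rfl, ?_, hva⟩
    rintro (_ | i) hi
    · simp only [hv0]; exact hSS' (Finset.mem_insert_self _ _)
    · exact hv i (by omega)

/-- An `ε`-chain of `G` becomes a true orbit after composing `G` with an `ε`-small injection. -/
theorem exists_perturbation {G : ℂ → ℂ} (hG : Continuous G) (hGi : Function.Injective G)
    {ε m a : ℝ} (hε : 0 ≤ ε) {k : ℕ} {z : ℂ} (hz : z ∈ chainSet G ε m a k) :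
    ∃ h : ℂ → ℂ, Continuous h ∧ Function.Injective h ∧ (∀ x, ‖h x - x‖ ≤ ε) ∧
      (∀ x : ℂ, x.im ≤ m → h x = x) ∧ a < ((h ∘ G)^[k] z).im := by
  obtain ⟨S, -, hS, w, hw0, hw, hwa⟩ := exists_generic_chain hG hGi k ∅ z
    ⟨by simp, by simp, by simp⟩ hz (by simp)
  obtain ⟨h, hc, hi, hd, hs, hid⟩ := exists_transport S hε hS.1 hS.2.1 hS.2.2
  refine ⟨h, hc, hi, hd, hid, ?_⟩
  have : ∀ i ≤ k, (h ∘ G)^[i] z = w i := by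
    intro i
    induction i with
    | zero => exact fun _ => hw0.symm
    | succ i ih =>
      intro hik
      rw [Function.iterate_succ_apply', ih (by omega)]
      exact hs _ (hw i (by omega))
  rwa [this k le_rfl]

theorem continuous_floor_fract {X : Type*} [TopologicalSpace X] {H : ℤ → ℝ → X}
    (hc : ∀ k, Continuous (H k)) (hH : ∀ k, H k 1 = H (k + 1) 0) :
    Continuous fun t : ℝ => H ⌊t⌋ (Int.fract t) := by
  have key : ∀ k : ℤ, ∀ t ∈ Icc (k : ℝ) (k + 1), H ⌊t⌋ (Int.fract t) = H k (t - k) := by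
    intro k t ht
    rcases ht.2.eq_or_lt with h | h
    · have : t = ((k + 1 : ℤ) : ℝ) := by push_cast; exact h
      rw [this, Int.floor_intCast, Int.fract_intCast, ← hH]
      congr 1; push_cast; ring
    · have : ⌊t⌋ = k := Int.floor_eq_iff.2 ⟨ht.1, h⟩
      rw [Int.fract, this]
  have hon : ∀ k : ℤ, ContinuousOn (fun t : ℝ => H ⌊t⌋ (Int.fract t)) (Icc (k : ℝ) (k + 1)) :=
    fun k => ContinuousOn.congr ((hc k).comp (by fun_prop :
      Continuous fun t : ℝ => t - k)).continuousOn (key k)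
  refine continuous_iff_continuousAt.2 fun t => ?_
  have h := (hon (⌊t⌋ - 1)).union_of_isClosed (hon ⌊t⌋) isClosed_Icc isClosed_Icc
  refine h.continuousAt ?_
  refine Filter.mem_of_superset (Ioo_mem_nhds (a := (⌊t⌋ : ℝ) - 1) (b := ⌊t⌋ + 1)
    (by linarith [Int.floor_le t]) (Int.lt_floor_add_one t)) ?_
  rintro x ⟨h1, h2⟩
  push_cast
  rcases le_total x ⌊t⌋ with h | h
  · exact Or.inl ⟨h1.le, by linarith⟩
  · exact Or.inr ⟨h, h2.le⟩

/-- A homeomorphism of the strip `0 ≤ im z ≤ 1` that twists its boundary to the left at the bottom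
and to the right at the top, extended horizontally to the plane. -/
structure IsPlaneTwist (F : ℂ → ℂ) (δ : ℝ) : Prop where
  continuous : Continuous F
  injective : Function.Injective F
  pos : 0 < δ
  low : ∀ z : ℂ, z.im ≤ 0 → (F z).im = z.im ∧ (F z).re ≤ z.re - δ
  high : ∀ z : ℂ, 1 ≤ z.im → (F z).im = z.im ∧ z.re + δ ≤ (F z).re
  mid : ∀ z : ℂ, 0 ≤ z.im → z.im ≤ 1 → 0 ≤ (F z).im ∧ (F z).im ≤ 1
  move : ∀ z, δ ≤ ‖F z - z‖
  surj : ∀ w : ℂ, w.im ≤ 0 → ∃ z : ℂ, z.im = w.im ∧ F z = w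

/-- There are arbitrarily fine pseudo-orbits of `F` from the line `im z = 0` to `im z = 1`. -/
def HasChains (F : ℂ → ℂ) : Prop :=
  ∀ ε > 0, ∃ n : ℕ, ∃ x : ℕ → ℂ, (x 0).im = 0 ∧ (x n).im = 1 ∧
    (∀ i ≤ n, 0 ≤ (x i).im ∧ (x i).im ≤ 1) ∧ ∀ i < n, ‖x (i + 1) - F (x i)‖ < ε

/-- The identity on the strip, pushing everything outside the strip upwards. -/
def stretch (z : ℂ) : ℂ := ⟨z.re, max (max z.im (z.im / 2)) (2 * z.im - 1)⟩

theorem continuous_stretch : Continuous stretch := by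
  have : stretch = fun z => ((z.re : ℝ) : ℂ) +
      ((max (max z.im (z.im / 2)) (2 * z.im - 1) : ℝ) : ℂ) * Complex.I := by
    funext z; apply Complex.ext <;> simp [stretch]
  rw [this]; fun_prop

theorem injective_stretch : Function.Injective stretch := by
  have hm : StrictMono fun y : ℝ => max (max y (y / 2)) (2 * y - 1) := fun a b hab => by
    refine max_lt_max (max_lt_max hab ?_) ?_ <;> linarith
  intro z w h
  have h1 := congrArg Complex.re h
  have h2 := congrArg Complex.im h
  exact Complex.ext h1 (hm.injective h2)

theorem stretch_re (z : ℂ) : (stretch z).re = z.re := rfl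

theorem stretch_im_low {z : ℂ} (h : z.im ≤ 0) : (stretch z).im = z.im / 2 := by
  simp only [stretch]
  rw [max_eq_right (a := z.im) (by linarith), max_eq_left (by linarith)]

theorem stretch_eq {z : ℂ} (h0 : 0 ≤ z.im) (h1 : z.im ≤ 1) : stretch z = z := by
  apply Complex.ext
  · rfl
  · simp only [stretch]
    rw [max_eq_left (a := z.im) (by linarith), max_eq_left (by linarith)]

theorem stretch_im_high {z : ℂ} (h : 1 ≤ z.im) : (stretch z).im = 2 * z.im - 1 := by
  simp only [stretch]
  rw [max_eq_left (a := z.im) (by linarith), max_eq_right (by linarith)]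

theorem mem_chainSet_succ {G : ℂ → ℂ} {ε m a : ℝ} (hε : 0 < ε) {k : ℕ} {z : ℂ}
    (hm : m < (G z).im) (h : G z ∈ chainSet G ε m a k) : z ∈ chainSet G ε m a (k + 1) :=
  ⟨hm, G z, h, hm, by simpa using hε⟩

namespace IsPlaneTwist

variable {F : ℂ → ℂ} {δ : ℝ}

theorem exists_pre (hF : IsPlaneTwist F δ) {w : ℂ} (hw : w.im ≤ 0) :
    ∃ z : ℂ, z.im = 2 * w.im ∧ stretch (F z) = w := by
  obtain ⟨z, h1, h2⟩ := hF.surj ⟨w.re, 2 * w.im⟩ (by simp only; linarith)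
  refine ⟨z, h1, ?_⟩
  rw [h2]
  apply Complex.ext
  · rfl
  · rw [stretch_im_low (by simp only; linarith)]; simp

theorem im_low (hF : IsPlaneTwist F δ) {z : ℂ} (h : z.im ≤ 0) :
    (stretch (F z)).im = z.im / 2 := by
  rw [stretch_im_low (by rw [(hF.low z h).1]; exact h), (hF.low z h).1]

theorem im_high (hF : IsPlaneTwist F δ) {z : ℂ} (h : 1 ≤ z.im) :
    (stretch (F z)).im = 2 * z.im - 1 := by
  rw [stretch_im_high (by rw [(hF.high z h).1]; exact h), (hF.high z h).1]

theorem mid_eq (hF : IsPlaneTwist F δ) {z : ℂ} (h : 0 ≤ z.im) (h1 : z.im ≤ 1) :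
    stretch (F z) = F z :=
  stretch_eq (hF.mid z h h1).1 (hF.mid z h h1).2

theorem ne (hF : IsPlaneTwist F δ) (z : ℂ) : F z ≠ z := fun h => by
  have := hF.move z
  rw [h, sub_self, norm_zero] at this
  linarith [hF.pos]

/-- Starting just below the strip one can cross it along a chain and leave it upwards. -/
theorem exists_start (hF : IsPlaneTwist F δ) (hch : HasChains F) {ε : ℝ} (hε : 0 < ε) :
    ∃ k, ∃ z : ℂ, z.im = -(3 / 2) ∧ z ∈ chainSet (stretch ∘ F) ε (-1) (1 + 2 * ε) k := by
  obtain ⟨n, x, h0, h1, h01, hx⟩ := hch ε hε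
  set G := stretch ∘ F with hG
  have up : ∀ z : ℂ, ∀ s : ℝ, 0 ≤ s → z.im = 1 + s → (G z).im = 1 + 2 * s := by
    intro z s hs hz
    have := hF.im_high (z := z) (by linarith)
    simp only [hG, Function.comp]; rw [this, hz]; ring
  have hup : ∀ z : ℂ, z.im = 1 + ε / 2 → z ∈ chainSet G ε (-1) (1 + 2 * ε) 3 := by
    intro z hz
    have e1 := up z _ (by linarith) hz
    have e2 := up _ _ (by linarith) e1
    have e3 := up _ _ (by linarith) e2
    refine mem_chainSet_succ hε (by linarith) (mem_chainSet_succ hε (by linarith)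
      (mem_chainSet_succ hε (by linarith) ?_))
    change 1 + 2 * ε < (G (G (G z))).im
    linarith
  have hGx : ∀ i ≤ n, G (x i) = F (x i) := fun i hi => hF.mid_eq (h01 i hi).1 (h01 i hi).2
  have hFx : ∀ i ≤ n, 0 ≤ (F (x i)).im := fun i hi => (hF.mid _ (h01 i hi).1 (h01 i hi).2).1
  have hlast : x n ∈ chainSet G ε (-1) (1 + 2 * ε) 4 := by
    have him := (hF.high (x n) h1.ge).1
    refine ⟨by rw [hGx n le_rfl]; linarith [hFx n le_rfl],
      F (x n) + ((ε / 2 : ℝ) : ℂ) * Complex.I, hup _ ?_, ?_, ?_⟩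
    · simp [him, h1]
    · simp [him, h1]; linarith
    · rw [hGx n le_rfl, add_sub_cancel_left, norm_mul, Complex.norm_I, Complex.norm_real,
        Real.norm_eq_abs, abs_of_pos (by linarith)]
      linarith
  have hdown : ∀ j ≤ n, x (n - j) ∈ chainSet G ε (-1) (1 + 2 * ε) (4 + j) := by
    intro j
    induction j with
    | zero => exact fun _ => hlast
    | succ j ih =>
      intro hj
      have e : n - (j + 1) + 1 = n - j := by omega
      have h2 := hx (n - (j + 1)) (by omega)
      rw [e] at h2
      refine ⟨?_, x (n - j), ih (by omega), ?_, ?_⟩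
      · rw [hGx _ (by omega)]; linarith [hFx (n - (j + 1)) (by omega)]
      · linarith [(h01 (n - j) (by omega)).1]
      · rwa [hGx _ (by omega)]
  have hx0 := hdown n le_rfl
  rw [Nat.sub_self] at hx0
  obtain ⟨J, hJ⟩ := exists_pow_lt_of_lt_one (show 0 < min 1 (ε / 2) by positivity)
    (show (1 / 2 : ℝ) < 1 by norm_num)
  set s : ℝ := 3 / 2 * (1 / 2) ^ J with hs
  have hs0 : 0 < s := by positivity
  have hsε : s < ε := by
    have := min_le_right 1 (ε / 2); rw [hs]; linarith
  have hs1 : s < 3 / 2 := by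
    have := min_le_left 1 (ε / 2); rw [hs]; linarith
  obtain ⟨y, hy, hGy⟩ := hF.exists_pre (w := ⟨(x 0).re, -(s / 2)⟩) (by simp only; linarith)
  have hyc : y ∈ chainSet G ε (-1) (1 + 2 * ε) (4 + n + 1) := by
    have hGy' : G y = ⟨(x 0).re, -(s / 2)⟩ := hGy
    refine ⟨by rw [hGy']; simp only; linarith, x 0, hx0, by rw [h0]; norm_num, ?_⟩
    have : x 0 - G y = ((s / 2 : ℝ) : ℂ) * Complex.I := by
      rw [hGy']; apply Complex.ext <;> simp [h0]
    rw [this, norm_mul, Complex.norm_I, Complex.norm_real, Real.norm_eq_abs,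
      abs_of_pos (by linarith)]
    linarith
  have hback : ∀ j ≤ J, ∃ z : ℂ, z.im = -(2 ^ j * s) ∧
      z ∈ chainSet G ε (-1) (1 + 2 * ε) (4 + n + 1 + j) := by
    intro j
    induction j with
    | zero =>
      refine fun _ => ⟨y, ?_, hyc⟩
      rw [hy]; simp only; ring
    | succ j ih =>
      intro hj
      obtain ⟨z, hz, hzc⟩ := ih (by omega)
      have hpos : 0 < 2 ^ j * s := by positivity
      obtain ⟨z', hz', hGz⟩ := hF.exists_pre (w := z) (by linarith)
      have hGz' : G z' = z := hGz
      refine ⟨z', by rw [hz', hz]; ring, mem_chainSet_succ hε ?_ (by rw [hGz']; exact hzc)⟩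
      rw [hGz', hz]
      have h3 : (2 : ℝ) ^ (j + 1) * s ≤ 2 ^ J * s := by
        gcongr
        norm_num
      have h4 : (2 : ℝ) ^ J * s = 3 / 2 := by
        rw [hs, one_div, inv_pow]; field_simp
      rw [pow_succ] at h3
      linarith
  obtain ⟨z, hz, hzc⟩ := hback J le_rfl
  refine ⟨_, z, ?_, hzc⟩
  rw [hz, hs, one_div, inv_pow]; field_simp

theorem exists_orbit (hF : IsPlaneTwist F δ) (hch : HasChains F) :
    ∃ G : ℂ → ℂ, Continuous G ∧ Function.Injective G ∧
      (∀ z : ℂ, -3 ≤ z.im → -(3 / 2) ≤ (G z).im) ∧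
      (∀ z : ℂ, 3 ≤ (G z).im → 1 ≤ z.im) ∧
      (∀ z, ∀ c : ℝ, 0 ≤ c → G z - z ≠ -(c : ℂ) * (F z - z)) ∧
      ∃ z : ℂ, z.im = -3 ∧ (G z).im = -(3 / 2) ∧ ∃ n : ℕ, 3 ≤ (G^[n] z).im := by
  set ε := min (δ / 2) (1 / 4) with hεdef
  have hδ := hF.pos
  have hε : 0 < ε := by positivity
  have hεδ : ε < δ := by have := min_le_left (δ / 2) (1 / 4 : ℝ); linarith
  have hε4 : ε ≤ 1 / 4 := min_le_right _ _
  obtain ⟨k, z₁, hz₁, hz₁c⟩ := hF.exists_start hch hε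
  have hG0c := continuous_stretch.comp hF.continuous
  have hG0i := injective_stretch.comp hF.injective
  obtain ⟨h, hc, hi, hd, hid, hend⟩ := exists_perturbation hG0c hG0i hε.le hz₁c
  have him : ∀ x : ℂ, |(h x).im - x.im| ≤ ε := fun x => by
    have := Complex.abs_im_le_norm (h x - x)
    rw [Complex.sub_im] at this
    exact this.trans (hd x)
  have hre : ∀ x : ℂ, |(h x).re - x.re| ≤ ε := fun x => by
    have := Complex.abs_re_le_norm (h x - x)
    rw [Complex.sub_re] at this
    exact this.trans (hd x)
  obtain ⟨z₀, hz₀, hG0z⟩ := hF.exists_pre (w := z₁) (by rw [hz₁]; norm_num)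
  have hGz₀ : (h ∘ stretch ∘ F) z₀ = z₁ := by
    simp only [Function.comp]
    rw [hG0z, hid z₁ (by rw [hz₁]; norm_num)]
  refine ⟨h ∘ stretch ∘ F, hc.comp hG0c, hi.comp hG0i, ?_, ?_, ?_, z₀, ?_, ?_, ?_⟩
  · intro z hz
    have h1 : -(3 / 2) ≤ (stretch (F z)).im := by
      rcases le_total z.im 0 with h0 | h0
      · rw [hF.im_low h0]; linarith
      rcases le_total z.im 1 with h1 | h1
      · rw [hF.mid_eq h0 h1]; linarith [(hF.mid z h0 h1).1]
      · rw [hF.im_high h1]; linarith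
    simp only [Function.comp]
    by_cases hle : (stretch (F z)).im ≤ -1
    · rwa [hid _ hle]
    · have := (abs_le.1 (him (stretch (F z)))).1
      linarith
  · intro z hz
    by_contra hcon
    push Not at hcon
    have h1 : (stretch (F z)).im ≤ 1 := by
      rcases le_total z.im 0 with h0 | h0
      · rw [hF.im_low h0]; linarith
      · rw [hF.mid_eq h0 hcon.le]; linarith [(hF.mid z h0 hcon.le).2]
    have := (abs_le.1 (him (stretch (F z)))).2
    simp only [Function.comp] at hz
    linarith
  · intro z c hc0 heq
    simp only [Function.comp] at heq
    have h2 := abs_le.1 (hre (stretch (F z)))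
    rw [stretch_re] at h2
    have h3 := congrArg Complex.re heq
    rw [← Complex.ofReal_neg, Complex.re_ofReal_mul, Complex.sub_re, Complex.sub_re] at h3
    rcases le_total z.im 0 with h0 | h0
    · have := (hF.low z h0).2
      nlinarith
    rcases le_total z.im 1 with h1 | h1
    · rw [hF.mid_eq h0 h1] at heq
      have e : h (F z) - F z = ((-(1 + c) : ℝ) : ℂ) * (F z - z) := by
        push_cast; linear_combination heq
      have := hd (F z)
      rw [e, norm_mul, Complex.norm_real, Real.norm_eq_abs, abs_neg,
        abs_of_pos (by linarith)] at this
      nlinarith [hF.move z]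
    · have := (hF.high z h1).2
      nlinarith
  · rw [hz₀, hz₁]; norm_num
  · rw [hGz₀, hz₁]
  · have grow : ∀ j : ℕ, 1 + ε + 2 ^ j * ε ≤ ((h ∘ stretch ∘ F)^[k + j] z₁).im := by
      intro j
      induction j with
      | zero => simp only [pow_zero, add_zero]; linarith
      | succ j ih =>
        rw [← add_assoc, Function.iterate_succ_apply']
        set w := (h ∘ stretch ∘ F)^[k + j] z₁
        have hpos : 0 < 2 ^ j * ε := by positivity
        have h1 := hF.im_high (z := w) (by linarith)
        have h2 := (abs_le.1 (him (stretch (F w)))).1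
        simp only [Function.comp]
        rw [pow_succ]
        linarith
    obtain ⟨j, hj⟩ := pow_unbounded_of_one_lt (2 / ε) (show (1 : ℝ) < 2 by norm_num)
    rw [div_lt_iff₀ hε] at hj
    refine ⟨k + j + 1, ?_⟩
    rw [Function.iterate_succ_apply, hGz₀]
    linarith [grow j]

/-- The direction of `F - id` turns by `-π` from the bottom to the top. -/
theorem exists_angle_eq_zero (hF : IsPlaneTwist F δ) (hch : HasChains F) {θ : ℂ → ℝ}
    (hθ : Continuous θ)
    (hθF : ∀ z, (θ z : Real.Angle) = (Complex.arg (F z - z) : Real.Angle))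
    (hlow : ∀ z : ℂ, z.im ≤ 0 → θ z = Real.pi) : ∃ z : ℂ, 1 ≤ z.im ∧ θ z = 0 := by
  obtain ⟨G, hGc, hGi, hG1, hG2, hopp, z₀, hz₀, hz₁, n, hn⟩ := hF.exists_orbit hch
  set α : ℝ → ℂ := fun u => z₀ + (u : ℂ) * (G z₀ - z₀) with hα
  have hα0 : α 0 = z₀ := by simp [hα]
  have hα1 : α 1 = G z₀ := by simp [hα]
  have hαim : ∀ u, (α u).im = -3 + 3 / 2 * u := fun u => by
    simp only [hα]; rw [Complex.add_im, Complex.im_ofReal_mul, Complex.sub_im, hz₀, hz₁]; ring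
  set H : ℤ → ℝ → ℂ := fun k u => if 0 ≤ k then G^[k.toNat] (α u) else z₀ with hH
  have hHn : ∀ (k : ℕ) u, H k u = G^[k] (α u) := fun k u => by simp [hH]
  set C : ℝ → ℂ := fun t => H ⌊t⌋ (Int.fract t) with hCdef
  have hC : Continuous C := by
    refine continuous_floor_fract (fun k => ?_) (fun k => ?_)
    · by_cases hk : 0 ≤ k
      · simp only [hH, hk, if_true]
        exact (hGc.iterate _).comp (by fun_prop)
      · simp only [hH, hk, if_false]; exact continuous_const
    · rcases lt_trichotomy k (-1) with hk | rfl | hk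
      · simp [hH, show ¬ 0 ≤ k by omega, show ¬ 0 ≤ k + 1 by omega]
      · simp [hH, hα0]
      · lift k to ℕ using by omega
        rw [hHn, show (k : ℤ) + 1 = ((k + 1 : ℕ) : ℤ) by push_cast; rfl, hHn, hα0, hα1,
          Function.iterate_succ_apply]
  have hCt : ∀ t, 0 ≤ t → C t = G^[⌊t⌋₊] (α (Int.fract t)) := fun t ht => by
    simp only [hCdef]
    rw [← Int.natCast_floor_eq_floor ht, hHn]
  have hCG : ∀ t, 0 ≤ t → C (t + 1) = G (C t) := fun t ht => by
    rw [hCt t ht, hCt (t + 1) (by linarith), Nat.floor_add_one ht, Function.iterate_succ_apply',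
      Int.fract_add_one]
  have hge : ∀ (k : ℕ) (z : ℂ), -3 ≤ z.im → -3 ≤ (G^[k] z).im := by
    intro k z hz
    induction k with
    | zero => exact hz
    | succ k ih => rw [Function.iterate_succ_apply']; linarith [hG1 _ ih]
  have hfr : ∀ t : ℝ, -3 ≤ (α (Int.fract t)).im ∧ (α (Int.fract t)).im < -(3 / 2) := fun t => by
    rw [hαim]
    constructor <;> linarith [Int.fract_nonneg t, Int.fract_lt_one t]
  have hne : ∀ s t, 0 ≤ s → s ≤ t → C (t + 1) ≠ C s := by
    intro s t hs hst heq
    have ht := hs.trans hst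
    obtain ⟨d, hd⟩ := Nat.exists_eq_add_of_le (Nat.floor_le_floor hst)
    rw [hCt s hs, hCt (t + 1) (by linarith), Nat.floor_add_one ht, hd, add_assoc,
      Function.iterate_add_apply] at heq
    have h1 := hGi.iterate _ heq
    rw [Function.iterate_succ_apply'] at h1
    have h2 := hG1 _ (hge d _ (hfr (t + 1)).1)
    rw [h1] at h2
    linarith [(hfr s).2]
  have hC0 : C 0 = z₀ := by rw [hCt 0 le_rfl]; simp [hα0]
  have hCn : C n = G^[n] z₀ := by rw [hCt n (by positivity)]; simp [hα0]
  obtain ⟨T, ⟨⟨hT0, hTn⟩, hT3⟩, hTmin⟩ :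
      ∃ T, IsLeast (Icc (0 : ℝ) n ∩ {t | 3 ≤ (C t).im}) T := by
    refine (isCompact_Icc.inter_right ?_).exists_isLeast ⟨n, ⟨by positivity, le_rfl⟩, ?_⟩
    · exact isClosed_le continuous_const (Complex.continuous_im.comp hC)
    · change 3 ≤ (C n).im
      rw [hCn]; exact hn
  have hT3' : 3 ≤ (C T).im := hT3
  have hlt : ∀ s, 0 ≤ s → s < T → (C s).im < 3 := by
    intro s h0 h1
    by_contra hcon
    exact absurd (hTmin ⟨⟨h0, h1.le.trans hTn⟩, not_lt.1 hcon⟩) (not_le.2 h1)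
  have hT1 : 1 ≤ T := by
    by_contra hcon
    push Not at hcon
    rw [hCt T hT0, Nat.floor_eq_zero.2 hcon] at hT3'
    simp only [Function.iterate_zero, id] at hT3'
    linarith [(hfr T).2]
  have hτ : 0 ≤ T - 1 := by linarith
  have hq := hG2 (C (T - 1)) (by rw [← hCG _ hτ, sub_add_cancel]; exact hT3')
  refine ⟨C (T - 1), hq, ?_⟩
  refine angle_eq_zero_of_positive_path (F := F) hC hτ (fun t ht => hCG t ht.1)
    (fun s t hs hst _ => hne s t hs hst) (fun t ht => ?_) (fun s hs => ?_) hF.ne hopp hθ hθF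
    (hlow _ (by rw [hC0, hz₀]; norm_num)) ?_ ?_
  · rw [hCG t ht.1, hC0, hz₀]
    have h2 := hG1 (C t) (by rw [hCt t ht.1]; exact hge _ _ (hfr t).1)
    linarith
  · rw [sub_add_cancel]
    linarith [hlt s hs.1 (by linarith [hs.2])]
  · rw [Complex.sub_re]; linarith [(hF.high _ hq).2, hF.pos]
  · rw [Complex.sub_im, (hF.high _ hq).1, sub_self]

end IsPlaneTwist

/-- The horizontal component of the unit steps east, north, west and south. -/
def stepX : Fin 4 → ℤ := ![1, 0, -1, 0]

/-- The vertical component of the unit steps east, north, west and south. -/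
def stepY : Fin 4 → ℤ := ![0, 1, 0, -1]

/-- With `ne nw sw se` telling which of the four cells at a vertex are marked: whether the edge
leaving in direction `d` has a marked cell on its left and an unmarked one on its right. -/
def leaves (ne nw sw se : Bool) : Fin 4 → Bool := ![ne && !se, nw && !ne, sw && !nw, se && !sw]

/-- The same as `leaves`, for the edge arriving in direction `d`. -/
def arrives (ne nw sw se : Bool) : Fin 4 → Bool := ![nw && !sw, sw && !se, se && !ne, ne && !nw]

/-- Turn left if possible, else go straight on, else turn right. -/
def turn (ne nw sw se : Bool) : Fin 4 → Fin 4 :=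
  ![if !ne then 1 else if !se then 0 else 3, if !nw then 2 else if !ne then 1 else 0,
    if !sw then 3 else if !nw then 2 else 1, if !se then 0 else if !sw then 3 else 2]

theorem leaves_turn : ∀ (ne nw sw se : Bool) (d : Fin 4), arrives ne nw sw se d →
    leaves ne nw sw se (turn ne nw sw se d) := by decide

theorem turn_injOn : ∀ (ne nw sw se : Bool) (d d' : Fin 4), arrives ne nw sw se d →
    arrives ne nw sw se d' → turn ne nw sw se d = turn ne nw sw se d' → d = d' := by decide

section Walk

variable {R : Type*} [Ring R] (U : R → ℤ → Bool)

/-- The edge from the vertex `(a, b)` in direction `d` has `U` on its left only. -/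
def IsBoundaryEdge (a : R) (b : ℤ) (d : Fin 4) : Prop :=
  leaves (U a b) (U (a - 1) b) (U (a - 1) (b - 1)) (U a (b - 1)) d

instance (a : R) (b : ℤ) (d : Fin 4) : Decidable (IsBoundaryEdge U a b d) :=
  inferInstanceAs (Decidable (_ = true))

/-- The boundary edge following a given one. -/
def nextEdge (e : (R × ℤ) × Fin 4) : (R × ℤ) × Fin 4 :=
  let a := e.1.1 + stepX e.2
  let b := e.1.2 + stepY e.2
  ((a, b), turn (U a b) (U (a - 1) b) (U (a - 1) (b - 1)) (U a (b - 1)) e.2)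

variable {U}

theorem IsBoundaryEdge.arrives {a : R} {b : ℤ} {d : Fin 4} (h : IsBoundaryEdge U a b d) :
    arrives (U (a + stepX d) (b + stepY d)) (U (a + stepX d - 1) (b + stepY d))
      (U (a + stepX d - 1) (b + stepY d - 1)) (U (a + stepX d) (b + stepY d - 1)) d := by
  fin_cases d <;>
    simpa [IsBoundaryEdge, leaves, _root_.arrives, stepX, stepY, sub_eq_add_neg] using h

theorem IsBoundaryEdge.nextEdge {e : (R × ℤ) × Fin 4} (h : IsBoundaryEdge U e.1.1 e.1.2 e.2) :
    IsBoundaryEdge U (nextEdge U e).1.1 (nextEdge U e).1.2 (nextEdge U e).2 :=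
  leaves_turn _ _ _ _ _ h.arrives

theorem nextEdge_injOn {e e' : (R × ℤ) × Fin 4} (h : IsBoundaryEdge U e.1.1 e.1.2 e.2)
    (h' : IsBoundaryEdge U e'.1.1 e'.1.2 e'.2) (he : nextEdge U e = nextEdge U e') : e = e' := by
  obtain ⟨⟨a, b⟩, d⟩ := e
  obtain ⟨⟨a', b'⟩, d'⟩ := e'
  have ha := congrArg (fun e => e.1.1) he
  have hb := congrArg (fun e => e.1.2) he
  have hd := congrArg (fun e => e.2) he
  have k := h.arrives
  have k' := h'.arrives
  simp only [_root_.nextEdge] at ha hb hd k k'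
  rw [← ha, ← hb] at hd k'
  obtain rfl := turn_injOn _ _ _ _ _ _ k k' hd
  simp_all

end Walk

section Cylinder

variable {N : ℕ} {U : ZMod N → ℤ → Bool}

theorem IsBoundaryEdge.mem_Icc {M : ℤ} (h0 : ∀ a b, b ≤ 0 → U a b = true)
    (h1 : ∀ a b, M ≤ b → U a b = false) {a : ZMod N} {b : ℤ} {d : Fin 4}
    (h : IsBoundaryEdge U a b d) : b ∈ Finset.Icc 0 (M + 1) := by
  rw [Finset.mem_Icc]
  by_contra hb
  rw [not_and_or, not_le, not_le] at hb
  rcases hb with hb | hb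
  · have e1 := fun a => h0 a b hb.le
    have e2 := fun a => h0 a (b - 1) (by lia)
    fin_cases d <;> simp [IsBoundaryEdge, leaves, e1, e2] at h
  · have e1 := fun a => h1 a b (by lia)
    have e2 := fun a => h1 a (b - 1) (by lia)
    fin_cases d <;> simp [IsBoundaryEdge, leaves, e1, e2] at h

theorem sum_stepX_leaves [NeZero N] {M : ℤ} (hM : 0 ≤ M) (h0 : ∀ a b, b ≤ 0 → U a b = true)
    (h1 : ∀ a b, M ≤ b → U a b = false) :
    ∑ b ∈ Finset.Icc 0 (M + 1), ∑ a : ZMod N, ∑ d : Fin 4,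
      (if leaves (U a b) (U (a - 1) b) (U (a - 1) (b - 1)) (U a (b - 1)) d then stepX d else 0)
      = -N := by
  have hrow : ∀ b, ∑ a : ZMod N, ∑ d : Fin 4,
      (if leaves (U a b) (U (a - 1) b) (U (a - 1) (b - 1)) (U a (b - 1)) d then stepX d else 0)
      = (∑ a, (U a b).toInt) - ∑ a, (U a (b - 1)).toInt := by
    intro b
    have e : ∀ a, ∑ d : Fin 4,
      (if leaves (U a b) (U (a - 1) b) (U (a - 1) (b - 1)) (U a (b - 1)) d then stepX d else 0)
      = (U a b && !U a (b - 1)).toInt - (U (a - 1) (b - 1) && !U (a - 1) b).toInt := by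
      intro a
      simp only [Fin.sum_univ_four, leaves, stepX]
      generalize U a b = p
      generalize U a (b - 1) = q
      generalize U (a - 1) b = r
      generalize U (a - 1) (b - 1) = s
      revert p q r s
      decide
    simp_rw [e]
    have shift := (Equiv.subRight (1 : ZMod N)).sum_comp fun a => (U a (b - 1) && !U a b).toInt
    simp only [Equiv.subRight_apply] at shift
    rw [Finset.sum_sub_distrib, shift, ← Finset.sum_sub_distrib, ← Finset.sum_sub_distrib]
    refine Finset.sum_congr rfl fun a _ => ?_
    generalize U a b = p
    generalize U a (b - 1) = q
    revert p q
    decide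
  simp_rw [hrow]
  have tele : ∀ k : ℕ, ∑ b ∈ Finset.Icc (0 : ℤ) k,
      ((∑ a, (U a b).toInt) - ∑ a, (U a (b - 1)).toInt)
      = (∑ a, (U a k).toInt) - ∑ a, (U a (-1)).toInt := by
    intro k
    induction k with
    | zero => simp
    | succ k ih =>
      have : Finset.Icc (0 : ℤ) ((k + 1 : ℕ) : ℤ) =
          insert ((k : ℤ) + 1) (Finset.Icc (0 : ℤ) k) := by
        ext x; simp only [Finset.mem_Icc, Finset.mem_insert]; push_cast; lia
      rw [this, Finset.sum_insert (by simp), ih]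
      push_cast
      rw [add_sub_cancel_right]
      ring
  obtain ⟨k, hk⟩ := Int.eq_ofNat_of_zero_le (by lia : 0 ≤ M + 1)
  rw [hk, tele k]
  simp only [h1 _ (k : ℤ) (by lia), h0 _ (-1) (by lia)]
  simp [ZMod.card]

theorem sum_stepX_boundary [NeZero N] {M : ℤ} (hM : 0 ≤ M) (h0 : ∀ a b, b ≤ 0 → U a b = true)
    (h1 : ∀ a b, M ≤ b → U a b = false)
    [Fintype {e : (ZMod N × ℤ) × Fin 4 // IsBoundaryEdge U e.1.1 e.1.2 e.2}] :
    ∑ e : {e : (ZMod N × ℤ) × Fin 4 // IsBoundaryEdge U e.1.1 e.1.2 e.2}, stepX e.1.2 = -N := by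
  rw [← sum_stepX_leaves hM h0 h1, ← Finset.sum_subtype
    ((((Finset.univ : Finset (ZMod N)) ×ˢ Finset.Icc 0 (M + 1)) ×ˢ Finset.univ).filter
      fun e : (ZMod N × ℤ) × Fin 4 => IsBoundaryEdge U e.1.1 e.1.2 e.2) _
      (fun e : (ZMod N × ℤ) × Fin 4 => stepX e.2),
    Finset.sum_filter, Finset.sum_product, Finset.sum_product_right]
  · rfl
  · intro e
    simp only [Finset.mem_filter, Finset.mem_product, Finset.mem_univ, true_and, and_true,
      and_iff_right_iff_imp]
    exact fun h => h.mem_Icc h0 h1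

variable (U) in
/-- A unit step along the boundary of (the lift of) `U`, with `U` on the left. -/
def IsWalkStep (p q : ℤ × ℤ) : Prop :=
  ∃ d, q = (p.1 + stepX d, p.2 + stepY d) ∧ IsBoundaryEdge U (p.1 : ZMod N) p.2 d

theorem exists_closed_walk [NeZero N] {M : ℤ} (hM : 0 ≤ M) (h0 : ∀ a b, b ≤ 0 → U a b = true)
    (h1 : ∀ a b, M ≤ b → U a b = false) :
    ∃ (n : ℕ) (w : ℕ → ℤ × ℤ) (m : ℤ), m ≠ 0 ∧ w n = ((w 0).1 + m * N, (w 0).2) ∧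
      ∀ i < n, IsWalkStep U (w i) (w (i + 1)) := by
  classical
  let E := {e : (ZMod N × ℤ) × Fin 4 // IsBoundaryEdge U e.1.1 e.1.2 e.2}
  have hfin : Finite E := by
    refine Set.Finite.to_subtype (s := {e | IsBoundaryEdge U e.1.1 e.1.2 e.2}) (Set.Finite.subset
      (((Finset.univ : Finset (ZMod N)) ×ˢ Finset.Icc 0 (M + 1)) ×ˢ Finset.univ).finite_toSet ?_)
    intro e he
    simpa using (IsBoundaryEdge.mem_Icc h0 h1 he)
  have : Fintype E := Fintype.ofFinite E
  let g : E → E := fun e => ⟨nextEdge U e.1, e.2.nextEdge⟩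
  have hg : Function.Injective g := fun e e' h =>
    Subtype.ext (nextEdge_injOn e.2 e'.2 (congrArg Subtype.val h))
  let σ : Equiv.Perm E := Equiv.ofBijective g (Finite.injective_iff_bijective.1 hg)
  have hK : 0 < orderOf σ := orderOf_pos σ
  set K := orderOf σ with hKdef
  have hsum : ∑ e : E, ∑ k ∈ Finset.range K, stepX ((σ ^ k) e).1.2 = K * -N := by
    rw [Finset.sum_comm]
    have : ∀ k ∈ Finset.range K, ∑ e : E, stepX ((σ ^ k) e).1.2 = -N := fun k _ => by
      rw [Equiv.sum_comp (σ ^ k) fun e : E => stepX e.1.2, sum_stepX_boundary hM h0 h1]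
    rw [Finset.sum_congr rfl this]
    simp
  obtain ⟨e, he⟩ : ∃ e : E, ∑ k ∈ Finset.range K, stepX ((σ ^ k) e).1.2 ≠ 0 := by
    by_contra! hcon
    rw [Finset.sum_eq_zero fun e _ => hcon e] at hsum
    have hN : (N : ℤ) ≠ 0 := by exact_mod_cast NeZero.ne N
    have hK' : (K : ℤ) ≠ 0 := by exact_mod_cast hK.ne'
    simp_all
  let w : ℕ → ℤ × ℤ := fun k => ((e.1.1.1.val : ℤ) + ∑ i ∈ Finset.range k, stepX ((σ ^ i) e).1.2,
    e.1.1.2 + ∑ i ∈ Finset.range k, stepY ((σ ^ i) e).1.2)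
  have hsucc : ∀ k, (σ ^ (k + 1)) e = g ((σ ^ k) e) := fun k => by
    rw [pow_succ', Equiv.Perm.mul_apply]; rfl
  have hw : ∀ k, (((w k).1 : ZMod N), (w k).2) = ((σ ^ k) e).1.1 := by
    intro k
    induction k with
    | zero => simp [w]
    | succ k ih =>
      rw [hsucc]
      simp only [g, nextEdge]
      rw [← ih]
      simp [w, Finset.sum_range_succ, add_assoc]
  have hend : (((w K).1 : ZMod N), (w K).2) = (((w 0).1 : ZMod N), (w 0).2) := by
    rw [hw, hw, hKdef, pow_orderOf_eq_one, pow_zero]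
  rw [Prod.mk.injEq, ← sub_eq_zero, ← Int.cast_sub, ZMod.intCast_zmod_eq_zero_iff_dvd] at hend
  obtain ⟨m, hm⟩ := hend.1
  refine ⟨K, w, m, ?_, Prod.ext (by simp only; linarith) hend.2, fun i _ => ?_⟩
  · rintro rfl
    refine he ?_
    simpa [w] using hm
  · refine ⟨((σ ^ i) e).1.2, ?_, ?_⟩
    · simp [w, Finset.sum_range_succ, add_assoc]
    · have := ((σ ^ i) e).2
      rw [← hw i] at this
      exact this

theorem IsWalkStep.add {p q : ℤ × ℤ} (h : IsWalkStep U p q) (k : ℤ) :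
    IsWalkStep U (p.1 + k * N, p.2) (q.1 + k * N, q.2) := by
  obtain ⟨d, rfl, h⟩ := h
  exact ⟨d, by ext <;> simp only []; ring, by simpa using h⟩

theorem exists_simple_walk [NeZero N] {M : ℤ} (hM : 0 ≤ M) (h0 : ∀ a b, b ≤ 0 → U a b = true)
    (h1 : ∀ a b, M ≤ b → U a b = false) :
    ∃ (n : ℕ) (w : ℕ → ℤ × ℤ) (m : ℤ), m ≠ 0 ∧ w n = ((w 0).1 + m * N, (w 0).2) ∧
      (∀ i < n, IsWalkStep U (w i) (w (i + 1))) ∧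
      ∀ i j k, i < j → j < n → w j ≠ ((w i).1 + k * N, (w i).2) := by
  classical
  have hex := exists_closed_walk hM h0 h1
  obtain ⟨w, m, hm, hn, hs⟩ := Nat.find_spec hex
  have hmin := fun k => @Nat.find_min _ _ hex k
  set n := Nat.find hex
  refine ⟨n, w, m, hm, hn, hs, fun i j k hij hj h => ?_⟩
  by_cases hk : k = 0
  · subst hk
    simp only [zero_mul, add_zero] at h
    have h' : w j = w i := h
    refine hmin (n - (j - i)) (by lia)
      ⟨fun t => if t ≤ i then w t else w (t + (j - i)), m, hm, ?_, fun t ht => ?_⟩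
    · simp only [Nat.zero_le, if_true]
      rw [if_neg (by lia), show n - (j - i) + (j - i) = n by lia, hn]
    · rcases lt_trichotomy t i with hti | rfl | hti
      · simp only [if_pos hti.le, if_pos (show t + 1 ≤ i by lia)]
        exact hs _ (by lia)
      · simp only [le_refl, if_true]
        rw [if_neg (by lia), ← h', show t + 1 + (j - t) = j + 1 by lia]
        exact hs _ hj
      · simp only
        rw [if_neg (by lia), if_neg (by lia), show t + 1 + (j - i) = t + (j - i) + 1 by lia]
        exact hs _ (by lia)
  · refine hmin (j - i) (by lia) ⟨fun t => w (i + t), k, hk, ?_, fun t ht => ?_⟩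
    · simp only [add_zero]
      rw [show i + (j - i) = j by lia, h]
    · exact hs (i + t) (by lia)

theorem IsWalkStep.abs_sub_le {p q : ℤ × ℤ} (h : IsWalkStep U p q) : |q.1 - p.1| ≤ 1 := by
  obtain ⟨d, rfl, -⟩ := h
  fin_cases d <;> simp [stepX]

/-- A simple closed walk along the boundary of `U` going around the cylinder, given as a
periodic bi-infinite walk. -/
theorem exists_periodic_walk (hN : 3 ≤ N) {M : ℤ} (hM : 0 ≤ M) (h0 : ∀ a b, b ≤ 0 → U a b = true)
    (h1 : ∀ a b, M ≤ b → U a b = false) :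
    ∃ (n m : ℤ) (V : ℤ → ℤ × ℤ), 3 ≤ n ∧ m ≠ 0 ∧ (∀ i, V (i + n) = ((V i).1 + m * N, (V i).2)) ∧
      (∀ i, IsWalkStep U (V i) (V (i + 1))) ∧
      ∀ i j k, V j = ((V i).1 + k * N, (V i).2) → n ∣ j - i := by
  have : NeZero N := ⟨by lia⟩
  obtain ⟨n, w, m, hm, hn, hs, hd⟩ := exists_simple_walk hM h0 h1
  have hlen : ∀ i ≤ n, |(w i).1 - (w 0).1| ≤ i := by
    intro i
    induction i with
    | zero => simp
    | succ i ih =>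
      intro hi
      have h1 := (hs i (by lia)).abs_sub_le
      have h2 := ih (by lia)
      push_cast
      rw [abs_le] at *
      constructor <;> linarith [h1.1, h1.2, h2.1, h2.2]
  have hn3 : 3 ≤ (n : ℤ) := by
    have h := hlen n le_rfl
    rw [hn] at h
    simp only [add_sub_cancel_left, abs_mul, Nat.abs_cast] at h
    have := Int.one_le_abs hm
    nlinarith
  have hn0 : (n : ℤ) ≠ 0 := by lia
  let V : ℤ → ℤ × ℤ := fun i => ((w (i % n).toNat).1 + i / n * m * N, (w (i % n).toNat).2)
  refine ⟨n, m, V, hn3, hm, fun i => ?_, fun i => ?_, fun i j k h => ?_⟩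
  · ext
    · simp only [V, Int.add_emod_right, Int.add_ediv_of_dvd_right (dvd_refl _), Int.ediv_self hn0]
      ring
    · simp only [V, Int.add_emod_right]
  · have hr0 := Int.emod_nonneg i hn0
    have hr1 := Int.emod_lt_of_pos i (show (0 : ℤ) < n by lia)
    have hi := Int.emod_add_mul_ediv i n
    set r := i % n with hr
    set q := i / n with hq
    obtain ⟨s, hs'⟩ := Int.eq_ofNat_of_zero_le hr0
    have hstep := (hs s (by lia)).add (q * m)
    have hVi : V i = ((w s).1 + q * m * N, (w s).2) := by
      simp only [V, ← hr, ← hq, hs', Int.toNat_natCast]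
    have hVi1 : V (i + 1) = ((w (s + 1)).1 + q * m * N, (w (s + 1)).2) := by
      by_cases hlt : s + 1 < n
      · have e1 : (i + 1) % n = (s + 1 : ℕ) := by
          rw [← hi, hs', show (s : ℤ) + n * q + 1 = (s + 1 : ℕ) + n * q by push_cast; ring,
            Int.add_mul_emod_self_left, Int.emod_eq_of_lt (by lia) (by lia)]
        have e2 : (i + 1) / n = q := by
          rw [← hi, hs', show (s : ℤ) + n * q + 1 = (s + 1 : ℕ) + n * q by push_cast; ring,
            Int.add_mul_ediv_left _ _ hn0, Int.ediv_eq_zero_of_lt (by lia) (by lia), zero_add]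
        simp only [V, e1, e2, Int.toNat_natCast]
      · have hsn : s + 1 = n := by lia
        have e0 : i + 1 = n * (q + 1) := by
          rw [← hi, hs', ← hsn]; push_cast; ring
        have e1 : (i + 1) % n = 0 := by rw [e0]; exact Int.mul_emod_right _ _
        have e2 : (i + 1) / n = q + 1 := by rw [e0]; exact Int.mul_ediv_cancel_left _ hn0
        simp only [V, e1, e2, hsn, hn, Int.toNat_zero]
        ext <;> simp only []
        ring
    rw [hVi, hVi1]
    exact hstep
  · have hb : ∀ i : ℤ, 0 ≤ i % n ∧ i % n < n := fun i =>
      ⟨Int.emod_nonneg i hn0, Int.emod_lt_of_pos i (by lia)⟩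
    simp only [V, Prod.mk.injEq] at h
    rcases lt_trichotomy (i % n) (j % n) with hlt | heq | hlt
    · refine (hd (i % n).toNat (j % n).toNat
        (i / n * m + k - j / n * m) (by have := hb i; lia) (by have := hb j; lia)
        (Prod.ext_iff.2 ⟨?_, h.2⟩)).elim
      linear_combination h.1
    · exact Int.ModEq.dvd heq
    · refine (hd (j % n).toNat (i % n).toNat
        (j / n * m - k - i / n * m) (by have := hb j; lia) (by have := hb i; lia)
        (Prod.ext_iff.2 ⟨?_, h.2.symm⟩)).elim
      linear_combination -h.1

end Cylinder

theorem eq_of_continuous_of_int {X : Type*} [TopologicalSpace X] [PreconnectedSpace X] {φ : X → ℝ}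
    (hφ : Continuous φ) (hint : ∀ x, ∃ k : ℤ, φ x = k) (x y : X) : φ x = φ y := by
  obtain ⟨j, hj⟩ := hint x
  have h := isPreconnected_univ.mem_Ioo_of_avoids (d := fun z => φ z - φ x) (a := -(1 / 2))
    (b := 1 / 2) (by fun_prop) (mem_univ x) (by norm_num) (fun z _ => ?_) (mem_univ y)
  · obtain ⟨k, hk⟩ := hint y
    simp only [hj, hk] at h ⊢
    have h1 : (k : ℝ) - j < 1 := by linarith [h.2]
    have h2 : (-1 : ℝ) < k - j := by linarith [h.1]
    have h1 : k - j < 1 := by exact_mod_cast h1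
    have h2 : -1 < k - j := by exact_mod_cast h2
    congr 1; lia
  · obtain ⟨k, hk⟩ := hint z
    simp only [hj, hk]
    constructor <;> intro h
    · have : (2 * (k - j) : ℝ) = -1 := by linarith
      have : 2 * (k - j) = -1 := by exact_mod_cast this
      lia
    · have : (2 * (k - j) : ℝ) = 1 := by linarith
      have : 2 * (k - j) = 1 := by exact_mod_cast this
      lia

theorem exists_int_of_coe_eq {x y : ℝ} (h : (x : S1) = y) : ∃ k : ℤ, x - y = k := by
  rw [← sub_eq_zero, ← AddCircle.coe_sub, AddCircle.coe_eq_zero_iff] at h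
  obtain ⟨k, hk⟩ := h
  exact ⟨k, by simpa using hk.symm⟩

theorem coe_add_int (x : ℝ) (k : ℤ) : ((x + k : ℝ) : S1) = x := by
  rw [AddCircle.coe_add, add_eq_left, AddCircle.coe_eq_zero_iff]
  exact ⟨k, by simp⟩

theorem exists_essential_curve {P : ℝ → ℝ × I01} (hP : Continuous P) {m : ℤ} (hm : m ≠ 0)
    (hper : ∀ t, P (t + 1) = ((P t).1 + m, (P t).2))
    (hinj : ∀ t t' : ℝ, ∀ k : ℤ, P t = ((P t').1 + k, (P t').2) → ∃ l : ℤ, t - t' = l) :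
    ∃ γ : C(S1, Ann), IsEssentialCurve γ ∧ ∀ t : ℝ, γ t = annCover (P t) := by
  have hcov : Continuous annCover := by
    unfold annCover
    exact ((AddCircle.continuous_mk' 1).comp continuous_fst).prodMk continuous_snd
  have hperiodic : Function.Periodic (fun t => annCover (P t)) 1 := fun t => by
    simp only [hper, annCover, coe_add_int]
  let γ : C(S1, Ann) := ⟨hperiodic.lift, (hcov.comp hP).quotient_lift _⟩
  have hγ : ∀ t : ℝ, γ t = annCover (P t) := fun t => hperiodic.lift_coe t
  refine ⟨γ, ⟨fun a b hab => ?_, ?_⟩, hγ⟩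
  · induction a using QuotientAddGroup.induction_on with | H t => ?_
    induction b using QuotientAddGroup.induction_on with | H t' => ?_
    have hab' : annCover (P t) = annCover (P t') := by rw [← hγ, ← hγ]; exact hab
    simp only [annCover, Prod.mk.injEq] at hab'
    obtain ⟨k, hk⟩ := exists_int_of_coe_eq hab'.1
    obtain ⟨l, hl⟩ := hinj t t' k (Prod.ext (by simp only; linarith) hab'.2)
    have : t = t' + l := by linarith
    rw [this]
    exact coe_add_int t' l
  · rintro ⟨y, ⟨H⟩⟩
    have hh : Continuous fun p : ℝ × ℝ => (H (projIcc 0 1 zero_le_one p.1, (p.2 : S1))).1 := by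
      refine continuous_fst.comp (H.continuous.comp (Continuous.prodMk ?_ ?_))
      · exact continuous_projIcc.comp continuous_fst
      · exact (AddCircle.continuous_mk' 1).comp continuous_snd
    obtain ⟨c, hc⟩ := QuotientAddGroup.mk_surjective y.1
    have hc : (c : S1) = y.1 := hc
    obtain ⟨ψ, ⟨-, hψ⟩, -⟩ := (AddCircle.isCoveringMap_coe (1 : ℝ)).existsUnique_continuousMap_lifts
      (⟨_, hh⟩ : C(ℝ × ℝ, S1)) (1, 0) c (by simp [hc])
    have hψ : ∀ s t : ℝ, ((ψ (s, t) : ℝ) : S1) = (H (projIcc 0 1 zero_le_one s, (t : S1))).1 :=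
      fun s t => congrFun hψ (s, t)
    have h0 := eq_of_continuous_of_int (φ := fun t => ψ (0, t) - (P t).1) (by fun_prop)
      (fun t => exists_int_of_coe_eq (by rw [hψ]; simp [hγ, annCover])) 0 1
    have h1 := eq_of_continuous_of_int (φ := fun t => ψ (1, t) - c) (by fun_prop)
      (fun t => exists_int_of_coe_eq (by rw [hψ]; simp [hc])) 0 1
    have h2 := eq_of_continuous_of_int (φ := fun s => ψ (s, 1) - ψ (s, 0)) (by fun_prop)
      (fun s => exists_int_of_coe_eq (by rw [hψ, hψ]; congr 3; simp)) 0 1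
    have h3 := congrArg Prod.fst (hper 0)
    simp only [zero_add] at h3
    have : (m : ℝ) = 0 := by linarith
    exact hm (by exact_mod_cast this)

theorem abs_mul_stepX_lt {s : ℝ} (d : Fin 4) (hs : s ∈ Ico 0 1) : |s * stepX d| < 1 := by
  rw [abs_lt]
  fin_cases d <;> simp [stepX] <;> constructor <;> linarith [hs.1, hs.2]

theorem abs_mul_stepY_lt {s : ℝ} (d : Fin 4) (hs : s ∈ Ico 0 1) : |s * stepY d| < 1 := by
  rw [abs_lt]
  fin_cases d <;> simp [stepY] <;> constructor <;> linarith [hs.1, hs.2]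

theorem edges_meet {p p' : ℤ × ℤ} {d d' : Fin 4} {s s' : ℝ} (hs : s ∈ Ico 0 1) (hs' : s' ∈ Ico 0 1)
    (h1 : (p.1 : ℝ) + s * stepX d = p'.1 + s' * stepX d')
    (h2 : (p.2 : ℝ) + s * stepY d = p'.2 + s' * stepY d') :
    (p = p' ∧ s = s') ∨ (p = (p'.1 + stepX d', p'.2 + stepY d') ∧
      p' = (p.1 + stepX d, p.2 + stepY d)) := by
  obtain ⟨x, y⟩ := p
  obtain ⟨x', y'⟩ := p'
  obtain ⟨a, rfl⟩ : ∃ a, x = x' + a := ⟨x - x', by ring⟩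
  obtain ⟨b, rfl⟩ : ∃ b, y = y' + b := ⟨y - y', by ring⟩
  obtain ⟨hs0, hs1⟩ := hs
  obtain ⟨hs0', hs1'⟩ := hs'
  simp only [Int.cast_add] at h1 h2
  have ha : a = -1 ∨ a = 0 ∨ a = 1 := by
    have : (-2 : ℝ) < a ∧ (a : ℝ) < 2 := by
      have e1 := abs_lt.1 (abs_mul_stepX_lt d ⟨hs0, hs1⟩)
      have e2 := abs_lt.1 (abs_mul_stepX_lt d' ⟨hs0', hs1'⟩)
      constructor <;> linarith [e1.1, e1.2, e2.1, e2.2]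
    have h1 : -2 < a := by exact_mod_cast this.1
    have h2 : a < 2 := by exact_mod_cast this.2
    lia
  have hb : b = -1 ∨ b = 0 ∨ b = 1 := by
    have : (-2 : ℝ) < b ∧ (b : ℝ) < 2 := by
      have e1 := abs_lt.1 (abs_mul_stepY_lt d ⟨hs0, hs1⟩)
      have e2 := abs_lt.1 (abs_mul_stepY_lt d' ⟨hs0', hs1'⟩)
      constructor <;> linarith [e1.1, e1.2, e2.1, e2.2]
    have h1 : -2 < b := by exact_mod_cast this.1
    have h2 : b < 2 := by exact_mod_cast this.2
    lia
  rcases ha with rfl | rfl | rfl <;> rcases hb with rfl | rfl | rfl <;> fin_cases d <;>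
    fin_cases d' <;> simp [stepX, stepY] at h1 h2 ⊢ <;> linarith

theorem IsBoundaryEdge.exists_cells {N : ℕ} {U : ZMod N → ℤ → Bool} {p : ℤ × ℤ} {d : Fin 4}
    (h : IsBoundaryEdge U (p.1 : ZMod N) p.2 d) {s : ℝ} (hs : s ∈ Icc 0 1) :
    (∃ a b : ℤ, U a b = true ∧ (p.1 + s * stepX d : ℝ) ∈ Icc (a : ℝ) (a + 1) ∧
      (p.2 + s * stepY d : ℝ) ∈ Icc (b : ℝ) (b + 1)) ∧
    ∃ a b : ℤ, U a b = false ∧ (p.1 + s * stepX d : ℝ) ∈ Icc (a : ℝ) (a + 1) ∧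
      (p.2 + s * stepY d : ℝ) ∈ Icc (b : ℝ) (b + 1) := by
  obtain ⟨hs0, hs1⟩ := hs
  fin_cases d <;> simp [IsBoundaryEdge, leaves] at h
  · refine ⟨⟨p.1, p.2, h.1, ?_⟩, p.1, p.2 - 1, h.2, ?_⟩ <;> simp [stepX, stepY, *]
  · refine ⟨⟨p.1 - 1, p.2, by simpa using h.1, ?_⟩, p.1, p.2, h.2, ?_⟩ <;>
      simp [stepX, stepY, *]
  · refine ⟨⟨p.1 - 1, p.2 - 1, by simpa using h.1, ?_⟩, p.1 - 1, p.2, by simpa using h.2, ?_⟩ <;>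
      simp [stepX, stepY, *] <;> linarith
  · refine ⟨⟨p.1, p.2 - 1, h.1, ?_⟩, p.1 - 1, p.2 - 1, by simpa using h.2, ?_⟩ <;>
      simp [stepX, stepY, *] <;> linarith

/-- The marked cells containing the bottom row and avoiding the top one are separated from the
others by an essential simple closed curve. -/
theorem exists_boundary_curve {N : ℕ} (hN : 3 ≤ N) {U : ZMod N → ℤ → Bool}
    (h0 : ∀ a b, b ≤ 0 → U a b = true) (h1 : ∀ a b, (N : ℤ) - 1 ≤ b → U a b = false) :
    ∃ γ : C(S1, Ann), IsEssentialCurve γ ∧ ∀ t, ∃ q : ℝ × I01, γ t = annCover q ∧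
      (∃ a b : ℤ, U a b = true ∧ N * q.1 ∈ Icc (a : ℝ) (a + 1) ∧
        N * (q.2 : ℝ) ∈ Icc (b : ℝ) (b + 1)) ∧
      ∃ a b : ℤ, U a b = false ∧ N * q.1 ∈ Icc (a : ℝ) (a + 1) ∧
        N * (q.2 : ℝ) ∈ Icc (b : ℝ) (b + 1) := by
  obtain ⟨n, m, V, hn, hm, hper, hstep, hd⟩ := exists_periodic_walk hN (by lia) h0 h1
  choose d hV hedge using hstep
  have hVx : ∀ i, (V (i + 1)).1 = (V i).1 + stepX (d i) := fun i => by rw [hV]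
  have hVy : ∀ i, (V (i + 1)).2 = (V i).2 + stepY (d i) := fun i => by rw [hV]
  let H : ℤ → ℝ → ℝ × ℝ := fun k s =>
    ((V k).1 + s * ((V (k + 1)).1 - (V k).1), (V k).2 + s * ((V (k + 1)).2 - (V k).2))
  have hH : ∀ k s, H k s = ((V k).1 + s * stepX (d k), (V k).2 + s * stepY (d k)) := fun k s => by
    simp [H, hVx, hVy]
  let Q : ℝ → ℝ × ℝ := fun u => H ⌊u⌋ (Int.fract u)
  have hQc : Continuous Q := continuous_floor_fract (fun k => by fun_prop) (fun k => by simp [H])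
  have hcells := fun u : ℝ => (hedge ⌊u⌋).exists_cells
    (s := Int.fract u) ⟨Int.fract_nonneg u, (Int.fract_lt_one u).le⟩
  have hQ : ∀ u, Q u = ((V ⌊u⌋).1 + Int.fract u * stepX (d ⌊u⌋),
    (V ⌊u⌋).2 + Int.fract u * stepY (d ⌊u⌋)) := fun u => hH _ _
  have hN0 : (0 : ℝ) < N := by exact_mod_cast (by lia : 0 < N)
  have hn0 : (n : ℝ) ≠ 0 := by exact_mod_cast (by lia : n ≠ 0)
  have hQ01 : ∀ u, (Q u).2 / N ∈ Icc (0 : ℝ) 1 := fun u => by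
    obtain ⟨⟨a, b, hab, -, hb⟩, a', b', hab', -, hb'⟩ := hcells u
    have e1 : b + 1 ≤ (N : ℤ) := by
      by_contra hcon
      simp [h1 _ b (by lia)] at hab
    have e2 : 0 ≤ b' := by
      by_contra hcon
      simp [h0 _ b' (by lia)] at hab'
    have e1 : (b : ℝ) + 1 ≤ N := by exact_mod_cast e1
    have e2 : (0 : ℝ) ≤ b' := by exact_mod_cast e2
    rw [hQ]
    exact ⟨div_nonneg (e2.trans hb'.1) hN0.le, (div_le_one hN0).2 (hb.2.trans e1)⟩
  have hQper : ∀ u, Q (u + n) = ((Q u).1 + m * N, (Q u).2) := fun u => by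
    have e : ∀ i, V (i + n + 1) = ((V (i + 1)).1 + m * N, (V (i + 1)).2) := fun i => by
      rw [← hper (i + 1)]; congr 1; ring
    simp only [Q, H, Int.floor_add_intCast, Int.fract_add_intCast, hper, e]
    push_cast
    ext <;> simp only []; ring
  let P : ℝ → ℝ × I01 := fun t => ((Q (n * t)).1 / N, ⟨(Q (n * t)).2 / N, hQ01 _⟩)
  have hPc : Continuous P := by fun_prop
  have hPper : ∀ t, P (t + 1) = ((P t).1 + m, (P t).2) := fun t => by
    have : (n : ℝ) * (t + 1) = n * t + n := by ring
    simp only [P, this, hQper]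
    refine Prod.ext ?_ rfl
    simp only
    field_simp
  have hPinj : ∀ t t' : ℝ, ∀ k : ℤ, P t = ((P t').1 + k, (P t').2) → ∃ l : ℤ, t - t' = l := by
    intro t t' k h
    have e1 := congrArg Prod.fst h
    have e2 := congrArg (fun z => (z.2 : ℝ)) h
    simp only [P] at e1 e2
    have e1 : (Q (n * t)).1 = (Q (n * t')).1 + k * N := by field_simp at e1; linarith
    have e2 : (Q (n * t)).2 = (Q (n * t')).2 := by field_simp at e2; linarith
    rw [hQ, hQ] at e1 e2
    set i := ⌊n * t⌋ with hi
    set j := ⌊n * t'⌋ with hj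
    rcases edges_meet (p := V i) (p' := ((V j).1 + k * N, (V j).2)) (d := d i) (d' := d j)
      ⟨Int.fract_nonneg (n * t), Int.fract_lt_one _⟩
      ⟨Int.fract_nonneg (n * t'), Int.fract_lt_one _⟩
      (by push_cast; linarith [e1]) (by linarith [e2]) with ⟨h3, h4⟩ | ⟨h3, h4⟩
    · obtain ⟨l, hl⟩ := hd j i k h3
      refine ⟨l, ?_⟩
      have hl : (i : ℝ) - j = n * l := by exact_mod_cast hl
      have f1 := Int.floor_add_fract (n * t)
      have f2 := Int.floor_add_fract (n * t')
      rw [← hi] at f1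
      rw [← hj] at f2
      have : (n : ℝ) * (t - t') = n * l := by linarith
      exact mul_left_cancel₀ hn0 this
    · have h5 := hd (j + 1) i k (by rw [h3, hV j]; ext <;> simp only []; ring)
      have h6 := hd j (i + 1) k (by rw [h4, hV i])
      have h7 := dvd_sub h6 h5
      rw [show i + 1 - j - (i - (j + 1)) = 2 by ring] at h7
      have := Int.le_of_dvd (by norm_num) h7
      lia
  obtain ⟨γ, hγ, hγP⟩ := exists_essential_curve hPc hm hPper hPinj
  refine ⟨γ, hγ, fun t => ?_⟩
  induction t using QuotientAddGroup.induction_on with | H t => ?_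
  refine ⟨_, hγP t, ?_⟩
  simp only [P, mul_div_cancel₀ _ hN0.ne', hQ]
  exact hcells (n * t)

/-- The embedding of the strip into the plane. -/
def stripEmb (q : ℝ × I01) : ℂ := ⟨q.1, q.2⟩

/-- The extension of a self-map of the strip to the plane, by translation on vertical rays. -/
def planeExt (F : ℝ × I01 → ℝ × I01) (z : ℂ) : ℂ :=
  stripEmb (F (z.re, projIcc 0 1 zero_le_one z.im)) +
    ((z.im - projIcc 0 1 zero_le_one z.im : ℝ) : ℂ) * Complex.I

theorem planeExt_stripEmb (F : ℝ × I01 → ℝ × I01) (q : ℝ × I01) :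
    planeExt F (stripEmb q) = stripEmb (F q) := by
  simp [planeExt, stripEmb, projIcc_val]

theorem norm_stripEmb_sub_le (p q : ℝ × I01) :
    ‖stripEmb p - stripEmb q‖ ≤ |p.1 - q.1| + |(p.2 : ℝ) - q.2| :=
  Complex.norm_le_abs_re_add_abs_im _

section Lift

variable {f : Ann → Ann} {F : ℝ × I01 → ℝ × I01}

theorem IsLift.add_int (h : IsLift f F) (p : ℝ × I01) (k : ℤ) :
    F (p.1 + k, p.2) = ((F p).1 + k, (F p).2) := by
  have key : ∀ (n : ℕ) (p : ℝ × I01), F (p.1 + n, p.2) = ((F p).1 + n, (F p).2) := by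
    intro n
    induction n with
    | zero => simp
    | succ n ih =>
      intro p
      have := h.2 (p.1 + n, p.2)
      rw [ih] at this
      push_cast
      simpa only [add_assoc] using this
  obtain ⟨n, rfl | rfl⟩ := k.eq_nat_or_neg
  · exact_mod_cast key n p
  · have := key n (p.1 - n, p.2)
    simp only [sub_add_cancel] at this
    rw [Prod.ext_iff] at this ⊢
    simp only [Int.cast_neg, Int.cast_natCast, ← sub_eq_add_neg]
    exact ⟨by simp only at this; rw [this.1]; ring, this.2.symm⟩

theorem IsLift.exists_eq (h : IsLift f F) {p q : ℝ × I01} (hpq : f (annCover p) = annCover q) :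
    ∃ k : ℤ, F (p.1 + k, p.2) = q := by
  rw [← h.1] at hpq
  simp only [annCover, Prod.mk.injEq] at hpq
  obtain ⟨k, hk⟩ := exists_int_of_coe_eq hpq.1
  refine ⟨-k, ?_⟩
  rw [h.add_int]
  exact Prod.ext (by push_cast; linarith) hpq.2

theorem IsLift.exists_horizontal (h : IsLift f F) (hF : Continuous F) {c : I01}
    (hc : ∀ x, (F (x, c)).2 = c) (y : ℝ) : ∃ x, F (x, c) = (y, c) := by
  have hk : ∀ k : ℤ, (F ((k : ℝ), c)).1 = (F (0, c)).1 + k := fun k => by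
    have := congrArg Prod.fst (h.add_int (0, c) k)
    simpa using this
  obtain ⟨x, hx⟩ := mem_range_of_exists_le_of_exists_ge
    (f := fun x : ℝ => (F (x, c)).1) (c := y) (by fun_prop)
    ⟨(⌊y - (F (0, c)).1⌋ : ℤ), by rw [hk]; linarith [Int.floor_le (y - (F (0, c)).1)]⟩
    ⟨(⌈y - (F (0, c)).1⌉ : ℤ), by rw [hk]; linarith [Int.le_ceil (y - (F (0, c)).1)]⟩
  exact ⟨x, Prod.ext hx (hc x)⟩

variable (F) in
/-- The points of the strip reached from its bottom line along `ε`-chains. -/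
def reachSet (ε : ℝ) : Set (ℝ × I01) :=
  {q | ∃ q₀ : ℝ × I01, q₀.2 = iZero ∧
    Relation.ReflTransGen (fun p q => ‖stripEmb q - stripEmb (F p)‖ < ε) q₀ q}

theorem mem_reachSet_of_norm_lt {ε : ℝ} {p q : ℝ × I01} (hp : p ∈ reachSet F ε)
    (h : ‖stripEmb q - stripEmb (F p)‖ < ε) : q ∈ reachSet F ε :=
  hp.imp fun _ hq₀ => ⟨hq₀.1, hq₀.2.tail h⟩

theorem IsLift.reachSet_add_int (h : IsLift f F) {ε : ℝ} {q : ℝ × I01} (hq : q ∈ reachSet F ε)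
    (k : ℤ) : (q.1 + k, q.2) ∈ reachSet F ε := by
  obtain ⟨q₀, h0, hq⟩ := hq
  refine ⟨(q₀.1 + k, q₀.2), h0, hq.lift (fun p : ℝ × I01 => (p.1 + k, p.2)) fun a b hab => ?_⟩
  simp only [Function.onFun, h.add_int]
  convert hab using 2
  simp [stripEmb, Complex.ext_iff]

theorem exists_chain_of_mem_reachSet {ε : ℝ} {q : ℝ × I01} (hq : q ∈ reachSet F ε) :
    ∃ n, ∃ x : ℕ → ℝ × I01, (x 0).2 = iZero ∧ x n = q ∧
      ∀ i < n, ‖stripEmb (x (i + 1)) - stripEmb (F (x i))‖ < ε := by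
  obtain ⟨q₀, h0, hq⟩ := hq
  induction hq with
  | refl => exact ⟨0, fun _ => q₀, h0, rfl, by simp⟩
  | tail _ hbc ih =>
    rename_i b c _
    obtain ⟨n, x, hx0, hxn, hx⟩ := ih
    refine ⟨n + 1, fun i => if i ≤ n then x i else c, by simpa, by simp, fun i hi => ?_⟩
    rcases (Nat.lt_succ_iff.1 hi).lt_or_eq with hi | rfl
    · simpa [hi.le, show i + 1 ≤ n by lia] using hx i hi
    · simpa [hxn] using hbc

theorem hasChains_of_reachSet (h : ∀ ε > 0, ∃ q ∈ reachSet F ε, q.2 = iOne) :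
    HasChains (planeExt F) := by
  intro ε hε
  obtain ⟨q, hq, hq1⟩ := h ε hε
  obtain ⟨n, x, h0, hn, hx⟩ := exists_chain_of_mem_reachSet hq
  refine ⟨n, fun i => stripEmb (x i), ?_, ?_, fun i _ => (x i).2.2, fun i hi => ?_⟩
  · simp [stripEmb, h0, iZero]
  · simp [stripEmb, hn, hq1, iOne]
  · rw [planeExt_stripEmb]; exact hx i hi

def cell (N : ℕ) (a b : ℤ) : Set (ℝ × I01) :=
  {q | N * q.1 ∈ Icc (a : ℝ) (a + 1) ∧ N * (q.2 : ℝ) ∈ Icc (b : ℝ) (b + 1)}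

theorem norm_lt_of_mem_cell {N : ℕ} {a b : ℤ} {ε : ℝ} (hN : 2 < N * ε) {p q : ℝ × I01}
    (hp : p ∈ cell N a b) (hq : q ∈ cell N a b) (hε : 0 < ε) :
    ‖stripEmb p - stripEmb q‖ < ε := by
  have hN0 : (0 : ℝ) < N := by
    by_contra hcon
    nlinarith
  obtain ⟨⟨h1, h2⟩, h3, h4⟩ := hp
  obtain ⟨⟨h5, h6⟩, h7, h8⟩ := hq
  have e1 : N * |p.1 - q.1| ≤ 1 := by
    rw [← abs_of_pos hN0, ← abs_mul, abs_le]
    constructor <;> linarith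
  have e2 : N * |(p.2 : ℝ) - q.2| ≤ 1 := by
    rw [← abs_of_pos hN0, ← abs_mul, abs_le]
    constructor <;> linarith
  refine (norm_stripEmb_sub_le p q).trans_lt (lt_of_mul_lt_mul_left ?_ hN0.le)
  linarith

theorem IsLift.hasChains (h : IsLift f F) (hF : Continuous F)
    (hbot : ∀ x, (F (x, iZero)).2 = iZero) (hint : IntersectionProperty f) :
    HasChains (planeExt F) := by
  classical
  refine hasChains_of_reachSet fun ε hε => ?_
  by_contra! hcon
  obtain ⟨N, hN⟩ := exists_nat_gt (max 3 (2 / ε))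
  have hN3 : 3 ≤ N := by exact_mod_cast ((le_max_left _ _).trans_lt hN).le
  have hNε : 2 < N * ε := by
    rw [← div_lt_iff₀ hε]; exact (le_max_right _ _).trans_lt hN
  have hN0 : (0 : ℝ) < N := by exact_mod_cast (by lia : 0 < N)
  have : NeZero N := ⟨by lia⟩
  let C : ℤ → ℤ → Prop := fun a b => b ≤ 0 ∨ ∃ q ∈ reachSet F ε, F q ∈ cell N a b
  have hCadd : ∀ a b k, C a b → C (a + k * N) b := by
    rintro a b k (hb | ⟨q, hq, hqc⟩)
    · exact Or.inl hb
    · refine Or.inr ⟨_, h.reachSet_add_int hq k, ?_⟩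
      rw [h.add_int]
      obtain ⟨⟨h1, h2⟩, h3⟩ := hqc
      refine ⟨⟨?_, ?_⟩, h3⟩ <;> push_cast <;> linarith
  let U : ZMod N → ℤ → Bool := fun a b => decide (C a.val b)
  have hU : ∀ a b : ℤ, U a b = true ↔ C a b := by
    intro a b
    have hv : (((a : ZMod N).val : ℕ) : ℤ) = a % N := ZMod.val_intCast a
    have hm := Int.emod_add_mul_ediv a N
    simp only [U, decide_eq_true_eq, hv]
    constructor <;> intro hC
    · have := hCadd _ _ (a / N) hC
      rwa [mul_comm, hm] at this
    · have := hCadd _ _ (-(a / N)) hC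
      rwa [show a + -(a / N) * N = a % N by linarith] at this
  have hCmem : ∀ a b q, C a b → q ∈ cell N a b → q ∈ reachSet F ε := by
    rintro a b q (hb | ⟨p, hp, hpc⟩) hq
    · obtain ⟨x, hx⟩ := h.exists_horizontal hF hbot q.1
      refine mem_reachSet_of_norm_lt (p := (x, iZero)) ⟨_, rfl, .refl⟩ ?_
      rw [hx]
      refine (norm_stripEmb_sub_le _ _).trans_lt (lt_of_mul_lt_mul_left ?_ hN0.le)
      have hb' : (b : ℝ) ≤ 0 := by exact_mod_cast hb
      have := hq.2.2
      simp only [iZero, sub_self, abs_zero, zero_add, sub_zero, abs_of_nonneg q.2.2.1]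
      linarith
    · exact mem_reachSet_of_norm_lt hp (norm_lt_of_mem_cell hNε hq hpc hε)
  have h1 : ∀ a b, (N : ℤ) - 1 ≤ b → U a b = false := by
    intro a b hb
    simp only [U, decide_eq_false_iff_not]
    rintro (hb' | ⟨q, hq, hqc⟩)
    · lia
    · refine hcon ((F q).1, iOne) (mem_reachSet_of_norm_lt hq ?_) rfl
      refine (norm_stripEmb_sub_le _ _).trans_lt (lt_of_mul_lt_mul_left ?_ hN0.le)
      have hb' : (N : ℝ) - 1 ≤ b := by exact_mod_cast hb
      have := hqc.2.1
      simp only [iOne, sub_self, abs_zero, zero_add, abs_of_nonneg (sub_nonneg.2 (F q).2.2.2)]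
      linarith
  have h0 : ∀ a b, b ≤ 0 → U a b = true := fun a b hb => decide_eq_true (Or.inl hb)
  obtain ⟨γ, hγ, hcells⟩ := exists_boundary_curve hN3 h0 h1
  obtain ⟨_, ⟨_, ⟨s, rfl⟩, hs⟩, t, rfl⟩ := hint γ hγ
  obtain ⟨q, hq, ⟨a, b, hab, hqc⟩, -⟩ := hcells s
  obtain ⟨p, hp, -, a', b', hab', hpc⟩ := hcells t
  rw [hq, hp] at hs
  obtain ⟨k, hk⟩ := h.exists_eq hs
  have hmem := h.reachSet_add_int (hCmem a b q ((hU a b).1 hab) hqc) k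
  have : U a' b' = true := (hU a' b').2 (Or.inr ⟨_, hmem, by rw [hk]; exact hpc⟩)
  rw [hab'] at this
  exact Bool.false_ne_true this

end Lift

theorem eq_of_continuousOn_of_angle_eq {X : Type*} [TopologicalSpace X] {s : Set X}
    (hs : IsPreconnected s) {θ : X → ℝ} (hθ : ContinuousOn θ s) {α : Real.Angle}
    (h : ∀ x ∈ s, (θ x : Real.Angle) = α) {x y : X} (hx : x ∈ s) (hy : y ∈ s) : θ x = θ y := by
  have := Subtype.preconnectedSpace hs
  have key := eq_of_continuous_of_int (φ := fun z : s => (θ z - θ x) / (2 * Real.pi))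
    ((hθ.domRestrict.sub continuous_const).div_const _) (fun z => ?_) ⟨x, hx⟩ ⟨y, hy⟩
  · simp only [sub_self, zero_div] at key
    rcases div_eq_zero_iff.1 key.symm with h | h
    · linarith
    · linarith [Real.pi_pos]
  · obtain ⟨k, hk⟩ := Real.Angle.angle_eq_iff_two_pi_dvd_sub.1 ((h z z.2).trans (h x hx).symm)
    exact ⟨k, by rw [hk]; field_simp⟩

theorem planeExt_sub (F : ℝ × I01 → ℝ × I01) (z : ℂ) :
    planeExt F z - z = stripEmb (F (z.re, projIcc 0 1 zero_le_one z.im)) -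
      stripEmb (z.re, projIcc 0 1 zero_le_one z.im) := by
  apply Complex.ext <;> simp [planeExt, stripEmb]
  ring

theorem continuous_stripEmb : Continuous stripEmb := by
  have : stripEmb = fun q => Complex.equivRealProdCLM.symm (q.1, (q.2 : ℝ)) := rfl
  rw [this]
  fun_prop

theorem continuous_planeExt {F : ℝ × I01 → ℝ × I01} (hF : Continuous F) :
    Continuous (planeExt F) := by
  have h : Continuous fun z : ℂ => projIcc (0 : ℝ) 1 zero_le_one z.im :=
    continuous_projIcc.comp Complex.continuous_im
  refine (continuous_stripEmb.comp (hF.comp (Complex.continuous_re.prodMk h))).add ?_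
  refine (Complex.continuous_ofReal.comp (Complex.continuous_im.sub ?_)).mul continuous_const
  exact continuous_subtype_val.comp h

theorem stripEmb_injective : Function.Injective stripEmb := fun p q h => by
  rw [stripEmb, stripEmb, Complex.mk.injEq] at h
  exact Prod.ext h.1 (Subtype.ext h.2)

theorem planeExt_of_im_le {F : ℝ × I01 → ℝ × I01} (h : ∀ x, (F (x, iZero)).2 = iZero) {z : ℂ}
    (hz : z.im ≤ 0) : planeExt F z = ⟨(F (z.re, iZero)).1, z.im⟩ := by
  have e : projIcc (0 : ℝ) 1 zero_le_one z.im = iZero := projIcc_of_le_left _ hz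
  have h' : ((F (z.re, iZero)).2 : ℝ) = 0 := congrArg Subtype.val (h z.re)
  have c : (iZero : ℝ) = 0 := rfl
  rw [planeExt, e]
  apply Complex.ext <;> simp [stripEmb, h', c]

theorem planeExt_of_le_im {F : ℝ × I01 → ℝ × I01} (h : ∀ x, (F (x, iOne)).2 = iOne) {z : ℂ}
    (hz : 1 ≤ z.im) : planeExt F z = ⟨(F (z.re, iOne)).1, z.im⟩ := by
  have e : projIcc (0 : ℝ) 1 zero_le_one z.im = iOne := projIcc_of_right_le _ hz
  have h' : ((F (z.re, iOne)).2 : ℝ) = 1 := congrArg Subtype.val (h z.re)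
  have c : (iOne : ℝ) = 1 := rfl
  rw [planeExt, e]
  apply Complex.ext <;> simp [stripEmb, h', c]

theorem exists_stripEmb_eq {z : ℂ} (h0 : 0 ≤ z.im) (h1 : z.im ≤ 1) : ∃ q, stripEmb q = z :=
  ⟨(z.re, ⟨z.im, h0, h1⟩), rfl⟩

theorem planeExt_comp_of_leftInverse {F G : ℝ × I01 → ℝ × I01} (hGF : Function.LeftInverse G F)
    (h0 : ∀ x, (F (x, iZero)).2 = iZero) (h1 : ∀ x, (F (x, iOne)).2 = iOne)
    (g0 : ∀ x, (G (x, iZero)).2 = iZero) (g1 : ∀ x, (G (x, iOne)).2 = iOne) (z : ℂ) :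
    planeExt G (planeExt F z) = z := by
  rcases le_total z.im 0 with hz | hz
  · rw [planeExt_of_im_le h0 hz, planeExt_of_im_le g0 (by exact hz)]
    have : ((F (z.re, iZero)).1, iZero) = F (z.re, iZero) := Prod.ext rfl (h0 _).symm
    simp [this, hGF _]
  rcases le_total 1 z.im with hz' | hz'
  · rw [planeExt_of_le_im h1 hz', planeExt_of_le_im g1 (by exact hz')]
    have : ((F (z.re, iOne)).1, iOne) = F (z.re, iOne) := Prod.ext rfl (h1 _).symm
    simp [this, hGF _]
  · obtain ⟨q, rfl⟩ := exists_stripEmb_eq hz hz'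
    rw [planeExt_stripEmb, planeExt_stripEmb, hGF]

/-- `F` is a lift of `f` moving the bottom line to the left and the top line to the right. -/
structure IsTwistLift (f : Ann ≃ₜ Ann) (F : (ℝ × I01) ≃ₜ (ℝ × I01)) : Prop where
  isLift : IsLift f F
  bot : ∀ x, (F (x, iZero)).2 = iZero
  top : ∀ x, (F (x, iOne)).2 = iOne
  bot_lt : ∀ x, (F (x, iZero)).1 < x
  lt_top : ∀ x, x < (F (x, iOne)).1

namespace IsTwistLift

variable {f : Ann ≃ₜ Ann} {F : (ℝ × I01) ≃ₜ (ℝ × I01)}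

theorem symm_bot (h : IsTwistLift f F) (x : ℝ) : (F.symm (x, iZero)).2 = iZero := by
  obtain ⟨y, hy⟩ := h.isLift.exists_horizontal F.continuous h.bot x
  rw [← hy, F.symm_apply_apply]

theorem symm_top (h : IsTwistLift f F) (x : ℝ) : (F.symm (x, iOne)).2 = iOne := by
  obtain ⟨y, hy⟩ := h.isLift.exists_horizontal F.continuous h.top x
  rw [← hy, F.symm_apply_apply]

theorem exists_le_norm_sub (h : IsTwistLift f F) (hfix : ∀ p, f p ≠ p) :
    ∃ δ > 0, ∀ q, δ ≤ ‖stripEmb (F q) - stripEmb q‖ := by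
  have hc : Continuous fun q => ‖stripEmb (F q) - stripEmb q‖ :=
    ((continuous_stripEmb.comp F.continuous).sub continuous_stripEmb).norm
  obtain ⟨q₀, -, hq₀⟩ := (isCompact_Icc.prod isCompact_univ :
    IsCompact (Icc (0 : ℝ) 1 ×ˢ (univ : Set I01))).exists_isMinOn
    ⟨(0, iZero), by simp⟩ hc.continuousOn
  have hne : stripEmb (F q₀) - stripEmb q₀ ≠ 0 := sub_ne_zero.2 fun hcon =>
    hfix (annCover q₀) (by rw [← h.isLift.1, stripEmb_injective hcon])
  refine ⟨_, norm_pos_iff.2 hne, fun q => ?_⟩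
  · refine (hq₀ (show (q.1 + (-⌊q.1⌋ : ℤ), q.2) ∈ Icc (0 : ℝ) 1 ×ˢ (univ : Set I01) from
      ⟨⟨?_, ?_⟩, mem_univ _⟩)).trans_eq ?_
    · push_cast; linarith [Int.floor_le q.1]
    · push_cast; linarith [Int.lt_floor_add_one q.1]
    · simp only [h.isLift.add_int]
      congr 1
      simp [stripEmb, Complex.ext_iff]

theorem isPlaneTwist (h : IsTwistLift f F) {δ : ℝ} (hδ : 0 < δ)
    (hF : ∀ q, δ ≤ ‖stripEmb (F q) - stripEmb q‖) : IsPlaneTwist (planeExt F) δ where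
  continuous := continuous_planeExt F.continuous
  injective := Function.LeftInverse.injective
    (planeExt_comp_of_leftInverse F.symm_apply_apply h.bot h.top h.symm_bot h.symm_top)
  pos := hδ
  low z hz := by
    rw [planeExt_of_im_le h.bot hz]
    refine ⟨rfl, ?_⟩
    have h1 := (hF (z.re, iZero)).trans (norm_stripEmb_sub_le _ _)
    rw [h.bot, sub_self, abs_zero, add_zero, abs_of_neg (sub_neg.2 (h.bot_lt _))] at h1
    simp only at h1 ⊢
    linarith
  high z hz := by
    rw [planeExt_of_le_im h.top hz]
    refine ⟨rfl, ?_⟩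
    have h1 := (hF (z.re, iOne)).trans (norm_stripEmb_sub_le _ _)
    rw [h.top, sub_self, abs_zero, add_zero, abs_of_pos (sub_pos.2 (h.lt_top _))] at h1
    simp only at h1 ⊢
    linarith
  mid z h0 h1 := by
    obtain ⟨q, rfl⟩ := exists_stripEmb_eq h0 h1
    rw [planeExt_stripEmb]
    exact (F q).2.2
  move z := by rw [planeExt_sub]; exact hF _
  surj w hw := by
    refine ⟨planeExt F.symm w, ?_, planeExt_comp_of_leftInverse F.apply_symm_apply
      h.symm_bot h.symm_top h.bot h.top w⟩
    rw [planeExt_of_im_le h.symm_bot hw]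

theorem exists_angle (h : IsTwistLift f F) (hfix : ∀ p, f p ≠ p) (hint : IntersectionProperty f) :
    ∃ θ : ℂ → ℝ, Continuous θ ∧
      (∀ z, (θ z : Real.Angle) = (Complex.arg (planeExt F z - z) : Real.Angle)) ∧
      (∀ z, z.im ≤ 0 → θ z = Real.pi) ∧ ∀ z, 1 ≤ z.im → θ z = 0 := by
  obtain ⟨δ, hδ, hF⟩ := h.exists_le_norm_sub hfix
  have hT := h.isPlaneTwist hδ hF
  have hlow : ∀ z : ℂ, z.im ≤ 0 → Complex.arg (planeExt F z - z) = Real.pi := fun z hz => by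
    have := hT.low z hz
    rw [Complex.arg_eq_pi_iff, Complex.sub_re, Complex.sub_im]
    constructor <;> linarith [this.1, this.2]
  have hhigh : ∀ z : ℂ, 1 ≤ z.im → Complex.arg (planeExt F z - z) = 0 := fun z hz => by
    have := hT.high z hz
    rw [Complex.arg_eq_zero_iff, Complex.sub_re, Complex.sub_im]
    constructor <;> linarith [this.1, this.2]
  obtain ⟨θ, hθ, hθ0, hθF⟩ := exists_angle_lift (hT.continuous.sub continuous_id)
    (fun z => sub_ne_zero.2 (hT.ne z)) 0 Real.pi (congrArg _ (hlow 0 le_rfl).symm)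
  have hpi : ∀ z : ℂ, z.im ≤ 0 → θ z = Real.pi := fun z hz => by
    rw [← hθ0]
    exact eq_of_continuousOn_of_angle_eq (convex_halfSpace_im_le 0).isPreconnected
      hθ.continuousOn (fun w hw => (hθF w).trans (congrArg _ (hlow w hw))) hz
      (show (0 : ℂ).im ≤ 0 from le_rfl)
  obtain ⟨z₁, hz₁, h₁⟩ := hT.exists_angle_eq_zero
    (h.isLift.hasChains F.continuous h.bot hint) hθ hθF hpi
  refine ⟨θ, hθ, hθF, hpi, fun z hz => ?_⟩
  rw [← h₁]
  exact eq_of_continuousOn_of_angle_eq (convex_halfSpace_im_ge 1).isPreconnected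
    hθ.continuousOn (fun w hw => (hθF w).trans (congrArg _ (hhigh w hw))) hz hz₁

end IsTwistLift

/-- Reflection of the first coordinate. -/
def reflect (G : Type*) [TopologicalSpace G] [AddGroup G] [IsTopologicalAddGroup G] :
    (G × I01) ≃ₜ (G × I01) :=
  (Homeomorph.neg G).prodCongr (Homeomorph.refl I01)

theorem IsTwistLift.conj_symm {f : Ann ≃ₜ Ann} {F : (ℝ × I01) ≃ₜ (ℝ × I01)}
    (h : IsTwistLift f F) :
    IsTwistLift ((reflect S1).trans (f.symm.trans (reflect S1)))
      ((reflect ℝ).trans (F.symm.trans (reflect ℝ))) := by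
  have hsymm : IsLift f.symm F.symm := by
    refine ⟨fun p => ?_, fun p => ?_⟩
    · rw [f.eq_symm_apply, ← h.isLift.1, F.apply_symm_apply]
    · rw [F.symm_apply_eq, h.isLift.2, F.apply_symm_apply]
  have hcov : ∀ p, annCover (reflect ℝ p) = reflect S1 (annCover p) := fun p => by
    simp [annCover, reflect]
  have happly : ∀ p : ℝ × I01, reflect ℝ p = (-p.1, p.2) := fun p => rfl
  refine ⟨⟨fun p => ?_, fun p => ?_⟩, fun x => ?_, fun x => ?_, fun x => ?_, fun x => ?_⟩
  · simp only [Homeomorph.trans_apply]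
    rw [hcov, hsymm.1, hcov]
  · simp only [Homeomorph.trans_apply, happly]
    have := hsymm.add_int (-p.1, p.2) (-1)
    push_cast at this
    rw [show -(p.1 + 1) = -p.1 + -1 by ring, this]
    exact Prod.ext (by simp only; ring) rfl
  · exact h.symm_bot _
  · exact h.symm_top _
  · have e : ((F.symm (-x, iZero)).1, iZero) = F.symm (-x, iZero) :=
      Prod.ext rfl (h.symm_bot _).symm
    have := h.bot_lt (F.symm (-x, iZero)).1
    rw [e, F.apply_symm_apply] at this
    simp only [Homeomorph.trans_apply, happly] at this ⊢
    linarith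
  · have e : ((F.symm (-x, iOne)).1, iOne) = F.symm (-x, iOne) :=
      Prod.ext rfl (h.symm_top _).symm
    have := h.lt_top (F.symm (-x, iOne)).1
    rw [e, F.apply_symm_apply] at this
    simp only [Homeomorph.trans_apply, happly] at this ⊢
    linarith

theorem reflect_reflect {G : Type*} [TopologicalSpace G] [AddGroup G] [IsTopologicalAddGroup G]
    (p : G × I01) : reflect G (reflect G p) = p :=
  Prod.ext (neg_neg _) rfl

theorem IsEssentialCurve.comp_reflect {γ : C(S1, Ann)} (h : IsEssentialCurve γ) :
    IsEssentialCurve ((ContinuousMap.mk _ (reflect S1).continuous).comp γ) := by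
  refine ⟨(reflect S1).injective.comp h.1, fun hcon => h.2 ?_⟩
  have := hcon.comp_right (ContinuousMap.mk _ (reflect S1).continuous)
  convert! this
  ext1 t
  exact (reflect_reflect _).symm

theorem IntersectionProperty.conj_symm {f : Ann ≃ₜ Ann} (h : IntersectionProperty f) :
    IntersectionProperty ((reflect S1).trans (f.symm.trans (reflect S1))) := by
  intro γ hγ
  obtain ⟨_, ⟨_, ⟨s, rfl⟩, hs⟩, t, rfl⟩ := h _ hγ.comp_reflect
  refine ⟨γ s, ⟨γ t, mem_range_self t, ?_⟩, mem_range_self s⟩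
  have hs : f (reflect S1 (γ s)) = reflect S1 (γ t) := hs
  simp only [Homeomorph.trans_apply]
  rw [← hs, f.symm_apply_apply, reflect_reflect]

theorem IsTwistLift.exists_fixed_point {f : Ann ≃ₜ Ann} {F : (ℝ × I01) ≃ₜ (ℝ × I01)}
    (h : IsTwistLift f F) (hint : IntersectionProperty f) : ∃ p, f p = p := by
  by_contra! hfix
  obtain ⟨θ, hθ, hθF, hlow, hhigh⟩ := h.exists_angle hfix hint
  obtain ⟨θ', hθ', hθF', hlow', hhigh'⟩ := h.conj_symm.exists_angle (fun p hp => by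
    refine hfix (reflect S1 p) ?_
    simp only [Homeomorph.trans_apply] at hp
    have := congrArg (reflect S1) hp
    rw [reflect_reflect, f.symm_apply_eq] at this
    exact this.symm) hint.conj_symm
  let S : ℂ → ℂ := fun z => -(starRingEnd ℂ z)
  have hS : ∀ p, S (stripEmb p) = stripEmb (reflect ℝ p) := fun p => by
    simp [S, stripEmb, reflect, Complex.ext_iff]
  have hSim : ∀ z, (S z).im = z.im := fun z => by simp [S]
  have hSc : Continuous S := by fun_prop
  have hext : ∀ z, planeExt ((reflect ℝ).trans (F.symm.trans (reflect ℝ))) (S z) - S z =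
      S (planeExt F.symm z - z) := fun z => by
    have e : ((S z).re, projIcc 0 1 zero_le_one (S z).im) =
        reflect ℝ (z.re, projIcc 0 1 zero_le_one z.im) := by
      rw [hSim]; simp [S, reflect]
    have hsub : ∀ a b, S (a - b) = S a - S b := fun a b => by simp only [S, map_sub]; ring
    rw [planeExt_sub, planeExt_sub, e, hsub, hS, hS]
    simp only [Homeomorph.trans_apply, reflect_reflect]
  have hc : Continuous (planeExt F) := continuous_planeExt F.continuous
  have hinv : ∀ w, S (planeExt F.symm (planeExt F w) - planeExt F w) =
      starRingEnd ℂ (planeExt F w - w) := fun w => by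
    rw [planeExt_comp_of_leftInverse F.symm_apply_apply h.bot h.top h.symm_bot h.symm_top]
    simp [S]
  have key := eq_of_continuousOn_of_angle_eq (α := 0) isPreconnected_univ
    (θ := fun w => θ' (S (planeExt F w)) + θ w) (by fun_prop) (fun w _ => by
      rw [Real.Angle.coe_add, hθF', hθF, hext, hinv, Complex.arg_conj_coe_angle, neg_add_cancel])
    (mem_univ 0) (mem_univ Complex.I)
  have h1 : (planeExt F 0).im = 0 := by rw [planeExt_of_im_le h.bot (by simp)]; rfl
  have h2 : (planeExt F Complex.I).im = 1 := by rw [planeExt_of_le_im h.top (by simp)]; simp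
  rw [hlow 0 (by simp), hhigh Complex.I (by simp), hlow' _ (by rw [hSim, h1]),
    hhigh' _ (by rw [hSim, h2])] at key
  linarith [Real.pi_pos]

/-- **Main theorem**: a homeomorphism of the annulus satisfying the twist condition
and the intersection property has at least one fixed point. -/
theorem annulus_twist_intersection_has_fixed_point (f : Ann ≃ₜ Ann)
    (htwist : TwistCondition ⇑f) (hint : IntersectionProperty ⇑f) :
    ∃ p : Ann, f p = p := by
  obtain ⟨F, hL, r₀, r₁, h₀, h₁, htop, hbot⟩ := htwist
  have h : IsTwistLift f F := by
    refine ⟨hL, fun x => ?_, fun x => ?_, fun x => ?_, fun x => ?_⟩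
    · rw [hbot]
    · rw [htop]
    · rw [hbot]
      exact sub_lt_self x (h₀ x)
    · rw [htop]
      exact lt_add_of_pos_right x (h₁ x)
  exact h.exists_fixed_point hint
end
end

section
/- Let f be a homeomorphism of a compact metric space X. Every connected component of the chain recurrent set ℛ(f) is chain transitive, i.e., for any two points p, q in the same connected component of ℛ(f) and any ε > 0, there exist ε-chains from p to q and from q to p. -/
open Set Metric

noncomputable section

/-- An `ε`-chain for `f` from `p` to `q`: a finite sequence `c 0 = p, …, c n = q`
with `n ≥ 1` and `dist (f (c i)) (c (i+1)) < ε` for all `i < n`. -/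
def EChain {X : Type*} [MetricSpace X] (f : X → X) (ε : ℝ) (p q : X) : Prop :=
  ∃ (n : ℕ) (c : ℕ → X), 0 < n ∧ c 0 = p ∧ c n = q ∧
    ∀ i < n, dist (f (c i)) (c (i + 1)) < ε

/-- A point is chain recurrent if for every `ε > 0` there is an `ε`-chain from it to itself. -/
def ChainRecurrent {X : Type*} [MetricSpace X] (f : X → X) (p : X) : Prop :=
  ∀ ε > 0, EChain f ε p p

/-- The chain recurrent set `ℛ(f)`. -/
def chainRecSet {X : Type*} [MetricSpace X] (f : X → X) : Set X :=
  {p | ChainRecurrent f p}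

/-- The equivalence relation `∼` on the chain recurrent set: `p ∼ q` iff for every
`ε > 0` there are `ε`-chains from `p` to `q` and from `q` to `p`. -/
def ChainEquiv {X : Type*} [MetricSpace X] (f : X → X) (p q : X) : Prop :=
  p ∈ chainRecSet f ∧ q ∈ chainRecSet f ∧
    ∀ ε > 0, EChain f ε p q ∧ EChain f ε q p

/-- The chain transitive component of a chain recurrent point `p`. -/
def chainComponent {X : Type*} [MetricSpace X] (f : X → X) (p : X) : Set X :=
  {q | ChainEquiv f p q}

/-- Concatenation of `ε`-chains. -/
theorem EChain.trans {X : Type*} [MetricSpace X] {f : X → X} {ε : ℝ} {p q r : X}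
    (hpq : EChain f ε p q) (hqr : EChain f ε q r) : EChain f ε p r := by
  obtain ⟨m, c, hm, hc0, hcm, hc⟩ := hpq
  obtain ⟨n, d, hn, hd0, hdn, hd⟩ := hqr
  refine ⟨m + n, fun i => if i < m then c i else d (i - m), by omega, by simp [hm, hc0],
    by simp [hdn], fun i hi => ?_⟩
  rcases lt_trichotomy (i + 1) m with h | h | h
  · simpa [h, show i < m by omega] using hc i (by omega)
  · subst h
    simpa [hd0, ← hcm] using hc i (by omega)
  · simpa [show ¬ i < m by omega, show ¬ i + 1 < m by omega,
      show i + 1 - m = i - m + 1 by omega] using hd (i - m) (by omega)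

/-- Moving the endpoint of a chain by less than `δ` costs at most `δ` in the size of the jumps. -/
theorem EChain.of_dist_lt {X : Type*} [MetricSpace X] {f : X → X} {ε δ : ℝ} {p q r : X}
    (h : EChain f ε p q) (hqr : dist q r < δ) : EChain f (ε + δ) p r := by
  obtain ⟨n, c, hn, hc0, hcn, hc⟩ := h
  refine ⟨n, Function.update c n r, hn, by simp [hn.ne, hc0], by simp, fun i hi => ?_⟩
  have hci := hc i hi
  rw [Function.update_of_ne hi.ne]
  rcases eq_or_ne (i + 1) n with h | h
  · rw [h, Function.update_self]
    rw [h, hcn] at hci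
    linarith [dist_triangle (f (c i)) q r]
  · rw [Function.update_of_ne h]
    linarith [dist_nonneg (x := q) (y := r)]

/-- Chain recurrent points at distance less than `ε / 2` are joined by an `ε`-chain. -/
theorem ChainRecurrent.eChain_of_dist_lt {X : Type*} [MetricSpace X] {f : X → X} {ε : ℝ}
    (hε : 0 < ε) {p q : X} (hp : ChainRecurrent f p) (hpq : dist p q < ε / 2) :
    EChain f ε p q := by
  simpa using (hp (ε / 2) (half_pos hε)).of_dist_lt hpq

/-- Any two points of a preconnected set of chain recurrent points are joined by `ε`-chains. -/
theorem IsPreconnected.eChain {X : Type*} [MetricSpace X] {f : X → X} {s : Set X}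
    (hs : IsPreconnected s) (hsf : s ⊆ chainRecSet f) {ε : ℝ} (hε : 0 < ε) {p q : X}
    (hp : p ∈ s) (hq : q ∈ s) : EChain f ε p q := by
  refine hs.induction₂' (EChain f ε) (fun x hx => ?_)
    (fun _ _ _ _ _ _ hxy hyz => hxy.trans hyz) hp hq
  filter_upwards [self_mem_nhdsWithin, mem_nhdsWithin_of_mem_nhds (ball_mem_nhds x (half_pos hε))]
    with y hy hyx
  exact ⟨ChainRecurrent.eChain_of_dist_lt hε (hsf hx) (mem_ball'.1 hyx),
    ChainRecurrent.eChain_of_dist_lt hε (hsf hy) (mem_ball.1 hyx)⟩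

/-- Connected components of the chain recurrent set of a homeomorphism of a compact
metric space are chain transitive: any two points in the same connected component of
`ℛ(f)` are joined by `ε`-chains in both directions, for every `ε > 0`. -/
theorem connectedComponent_of_chainRecSet_chainTransitive
    {X : Type*} [MetricSpace X] [CompactSpace X] (f : X ≃ₜ X)
    (p q : X) (hp : p ∈ chainRecSet ⇑f)
    (hq : q ∈ connectedComponentIn (chainRecSet ⇑f) p) :
    ∀ ε > 0, EChain ⇑f ε p q ∧ EChain ⇑f ε q p := by
  intro ε hε
  have hconn := isPreconnected_connectedComponentIn (x := p) (F := chainRecSet ⇑f)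
  have hsub := connectedComponentIn_subset (chainRecSet ⇑f) p
  have hpp := mem_connectedComponentIn hp
  exact ⟨hconn.eChain hsub hε hpp hq, hconn.eChain hsub hε hq hpp⟩
end
end
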